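/- Let ρ₀, ρ₁ ∈ M₊(Ω) with ρ₀(Ω) = ρ₁(Ω), and assume that ρ₀ or ρ₁ is absolutely continuous with respect to the Lebesgue measure. Then the minimizer of J_{ρ₀,ρ₁} on M([0,1]×Ω) × M([0,1]×Ω;ℝ^d) is unique. -/

import Mathlib

open MeasureTheory Set Filter Topology
open scoped ENNReal NNReal

noncomputable section

abbrev Euc (d : ℕ) : Type := EuclideanSpace ℝ (Fin d)

/-- Integral of a function against a finite signed measure. -/
def sInt {X : Type*} [MeasurableSpace X] (ν : SignedMeasure X) (f : X → ℝ) : ℝ :=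
  (∫ x, f x ∂ν.toJordanDecomposition.posPart) - ∫ x, f x ∂ν.toJordanDecomposition.negPart

/-- Total variation norm of a finite signed measure. -/
def sTV {X : Type*} [MeasurableSpace X] (ν : SignedMeasure X) : ℝ :=
  (ν.totalVariation Set.univ).toReal

/-- Pairing of an `ℝ^d`-valued measure (given componentwise) with a vector field. -/
def vInt {X : Type*} [MeasurableSpace X] {d : ℕ} (m : Fin d → SignedMeasure X)
    (b : X → Euc d) : ℝ :=
  ∑ i, sInt (m i) fun x => b x i

/-- Total variation norm of a vector measure, via duality with continuous fields. -/
def vTV {X : Type*} [MeasurableSpace X] [TopologicalSpace X] {d : ℕ}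
    (m : Fin d → SignedMeasure X) : ℝ :=
  ⨆ b : {b : C(X, Euc d) // ∀ x, ‖b x‖ ≤ 1}, vInt m fun x => (b : C(X, Euc d)) x

/-- The Benamou-Brenier action. -/
def actionBB {X : Type*} [MeasurableSpace X] [TopologicalSpace X] {d : ℕ}
    (ρ : SignedMeasure X) (m : Fin d → SignedMeasure X) : ℝ≥0∞ :=
  ⨆ p : {q : C(X, ℝ) × C(X, Euc d) // ∀ x, q.1 x + ‖q.2 x‖ ^ 2 / 2 ≤ 0},
    ENNReal.ofReal (sInt ρ (p : C(X, ℝ) × C(X, Euc d)).1 + vInt m (p : C(X, ℝ) × C(X, Euc d)).2)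

/-- The space-time domain `[0,1] × Ω`. -/
abbrev STt (d : ℕ) (Ω : Set (Euc d)) : Type := ↥(Icc (0:ℝ) 1) × ↥Ω

def STemb {d : ℕ} {Ω : Set (Euc d)} (p : STt d Ω) : ℝ × Euc d := ((p.1 : ℝ), (p.2 : Euc d))

/-- The (weak formulation of the) continuity equation with temporal boundary data `ρ₀, ρ₁`. -/
def CEeq (d : ℕ) (Ω : Set (Euc d)) (ρ₀ ρ₁ : SignedMeasure ↥Ω)
    (ρ : SignedMeasure (STt d Ω)) (m : Fin d → SignedMeasure (STt d Ω)) : Prop :=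
  ∀ φ : ℝ × Euc d → ℝ, ContDiff ℝ 1 φ →
    sInt ρ (fun p => fderiv ℝ φ (STemb p) (1, 0)) +
      ∑ i, sInt (m i) (fun p => fderiv ℝ φ (STemb p) (0, EuclideanSpace.single i 1)) =
    sInt ρ₁ (fun x => φ (1, (x : Euc d))) - sInt ρ₀ (fun x => φ (0, (x : Euc d)))

open scoped Classical in
/-- The functional `J_{ρ₀,ρ₁}`. -/
def Jfun (d : ℕ) (Ω : Set (Euc d)) (ρ₀ ρ₁ : SignedMeasure ↥Ω)
    (ρ : SignedMeasure (STt d Ω)) (m : Fin d → SignedMeasure (STt d Ω)) : ℝ≥0∞ :=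
  if CEeq d Ω ρ₀ ρ₁ ρ m then actionBB ρ m else ⊤

/-- The quadratic Wasserstein distance. -/
def W2 {d : ℕ} {Ω : Set (Euc d)} (μ ν : Measure ↥Ω) : ℝ :=
  Real.sqrt (sInf {c : ℝ | ∃ π : Measure (↥Ω × ↥Ω), IsFiniteMeasure π ∧
    π.map Prod.fst = μ ∧ π.map Prod.snd = ν ∧
    c = ∫ p, ‖(p.1 : Euc d) - (p.2 : Euc d)‖ ^ 2 ∂π})

section SignedIntegral

lemma sInt_const_mul {X : Type*} [MeasurableSpace X] (s : SignedMeasure X) (c : ℝ) (f : X → ℝ) :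
    sInt s (fun x => c * f x) = c * sInt s f := by
  unfold sInt
  rw [integral_const_mul, integral_const_mul]
  ring

variable {X : Type*} [TopologicalSpace X] [CompactSpace X] [MeasurableSpace X] [BorelSpace X]

lemma integrable_of_continuous (μ : Measure X) [IsFiniteMeasure μ] {f : X → ℝ}
    (hf : Continuous f) : Integrable f μ :=
  hf.integrable_of_hasCompactSupport (HasCompactSupport.of_compactSpace f)

lemma sInt_eq_of_eq_sub {s : SignedMeasure X} {μ ν : Measure X} [IsFiniteMeasure μ]
    [IsFiniteMeasure ν] (hs : s = μ.toSignedMeasure - ν.toSignedMeasure) {f : X → ℝ}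
    (hf : Continuous f) : sInt s f = (∫ x, f x ∂μ) - ∫ x, f x ∂ν := by
  have h1 : s = s.toJordanDecomposition.posPart.toSignedMeasure
      - s.toJordanDecomposition.negPart.toSignedMeasure :=
    (SignedMeasure.toSignedMeasure_toJordanDecomposition s).symm
  have h2 : s.toJordanDecomposition.posPart + ν = s.toJordanDecomposition.negPart + μ := by
    rw [← Measure.toSignedMeasure_eq_toSignedMeasure_iff, Measure.toSignedMeasure_add,
      Measure.toSignedMeasure_add]
    have h3 := h1.symm.trans hs
    rw [sub_eq_sub_iff_add_eq_add] at h3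
    rw [h3, add_comm]
  have h3 : ∫ x, f x ∂(s.toJordanDecomposition.posPart + ν)
      = ∫ x, f x ∂(s.toJordanDecomposition.negPart + μ) := by rw [h2]
  rw [integral_add_measure (integrable_of_continuous _ hf) (integrable_of_continuous _ hf),
    integral_add_measure (integrable_of_continuous _ hf) (integrable_of_continuous _ hf)] at h3
  unfold sInt
  linarith

lemma sInt_toSignedMeasure (μ : Measure X) [IsFiniteMeasure μ] {f : X → ℝ}
    (hf : Continuous f) : sInt μ.toSignedMeasure f = ∫ x, f x ∂μ := by
  rw [sInt_eq_of_eq_sub (μ := μ) (ν := 0) (by simp) hf]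
  simp

lemma sInt_add_left (s t : SignedMeasure X) {f : X → ℝ} (hf : Continuous f) :
    sInt (s + t) f = sInt s f + sInt t f := by
  rw [sInt_eq_of_eq_sub (s := s + t)
    (μ := s.toJordanDecomposition.posPart + t.toJordanDecomposition.posPart)
    (ν := s.toJordanDecomposition.negPart + t.toJordanDecomposition.negPart) _ hf]
  · rw [integral_add_measure (integrable_of_continuous _ hf) (integrable_of_continuous _ hf),
      integral_add_measure (integrable_of_continuous _ hf) (integrable_of_continuous _ hf)]
    unfold sInt
    ring
  · rw [Measure.toSignedMeasure_add, Measure.toSignedMeasure_add, add_sub_add_comm]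
    congr 1
    · exact (SignedMeasure.toSignedMeasure_toJordanDecomposition s).symm
    · exact (SignedMeasure.toSignedMeasure_toJordanDecomposition t).symm

lemma sInt_smul_left (c : ℝ≥0) (s : SignedMeasure X) {f : X → ℝ} (hf : Continuous f) :
    sInt (c • s) f = c * sInt s f := by
  rw [sInt_eq_of_eq_sub (s := c • s) (μ := c • s.toJordanDecomposition.posPart)
    (ν := c • s.toJordanDecomposition.negPart) _ hf]
  · rw [integral_smul_nnreal_measure, integral_smul_nnreal_measure]
    unfold sInt
    simp only [NNReal.smul_def, smul_eq_mul]
    ring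
  · conv_lhs => rw [← SignedMeasure.toSignedMeasure_toJordanDecomposition s]
    rw [Measure.toSignedMeasure_smul, Measure.toSignedMeasure_smul]
    ext i hi
    simp [JordanDecomposition.toSignedMeasure, NNReal.smul_def, mul_sub]

lemma sInt_add_right (s : SignedMeasure X) {f g : X → ℝ} (hf : Continuous f)
    (hg : Continuous g) : sInt s (fun x => f x + g x) = sInt s f + sInt s g := by
  unfold sInt
  rw [integral_add (integrable_of_continuous _ hf) (integrable_of_continuous _ hg),
    integral_add (integrable_of_continuous _ hf) (integrable_of_continuous _ hg)]
  ring

lemma sInt_sub_right (s : SignedMeasure X) {f g : X → ℝ} (hf : Continuous f)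
    (hg : Continuous g) : sInt s (fun x => f x - g x) = sInt s f - sInt s g := by
  unfold sInt
  rw [integral_sub (integrable_of_continuous _ hf) (integrable_of_continuous _ hg),
    integral_sub (integrable_of_continuous _ hf) (integrable_of_continuous _ hg)]
  ring

/-- Integration against a signed measure as a linear functional on continuous functions. -/
def sIntLinear (s : SignedMeasure X) : C(X, ℝ) →ₗ[ℝ] ℝ where
  toFun f := sInt s f
  map_add' f g := sInt_add_right s f.continuous g.continuous
  map_smul' c f := sInt_const_mul s c f

lemma continuous_sIntLinear (s : SignedMeasure X) : Continuous (sIntLinear s) := by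
  refine AddMonoidHomClass.continuous_of_bound (sIntLinear s)
    (s.toJordanDecomposition.posPart.real univ + s.toJordanDecomposition.negPart.real univ)
    fun f => ?_
  have key : ∀ (μ : Measure X) [IsFiniteMeasure μ], ‖∫ x, f x ∂μ‖ ≤ ‖f‖ * μ.real univ :=
    fun μ _ => norm_integral_le_of_norm_le_const (Eventually.of_forall fun x => f.norm_coe_le_norm x)
  calc ‖sIntLinear s f‖ ≤ ‖∫ x, f x ∂s.toJordanDecomposition.posPart‖
      + ‖∫ x, f x ∂s.toJordanDecomposition.negPart‖ := norm_sub_le _ _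
    _ ≤ _ := by
      have := key s.toJordanDecomposition.posPart
      have := key s.toJordanDecomposition.negPart
      linarith

lemma signedMeasure_ext_of_sInt [HasOuterApproxClosed X] {s t : SignedMeasure X}
    (h : ∀ f : C(X, ℝ), sInt s f = sInt t f) : s = t := by
  have h2 : s.toJordanDecomposition.posPart + t.toJordanDecomposition.negPart
      = t.toJordanDecomposition.posPart + s.toJordanDecomposition.negPart := by
    refine ext_of_forall_integral_eq_of_IsFiniteMeasure fun f => ?_
    have hf : Continuous f := f.continuous
    rw [integral_add_measure (integrable_of_continuous _ hf) (integrable_of_continuous _ hf),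
      integral_add_measure (integrable_of_continuous _ hf) (integrable_of_continuous _ hf)]
    have := h f.toContinuousMap
    unfold sInt at this
    simp only [BoundedContinuousFunction.coe_toContinuousMap] at this
    linarith
  rw [← SignedMeasure.toSignedMeasure_toJordanDecomposition s,
    ← SignedMeasure.toSignedMeasure_toJordanDecomposition t]
  unfold JordanDecomposition.toSignedMeasure
  rw [sub_eq_sub_iff_add_eq_add, ← Measure.toSignedMeasure_add, ← Measure.toSignedMeasure_add,
    Measure.toSignedMeasure_eq_toSignedMeasure_iff, h2]

end SignedIntegral

section Transport

lemma exists_linear_le_sublinear_eq {E : Type*} [AddCommGroup E] [Module ℝ E] (N : E → ℝ)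
    (N_hom : ∀ c : ℝ, 0 < c → ∀ x, N (c • x) = c * N x)
    (N_add : ∀ x y, N (x + y) ≤ N x + N y) (x₀ : E) :
    ∃ g : E →ₗ[ℝ] ℝ, g x₀ = N x₀ ∧ ∀ x, g x ≤ N x := by
  have N0 : N 0 = 0 := by
    have := N_hom 2 (by norm_num) 0
    rw [smul_zero] at this
    linarith
  by_cases h0 : x₀ = 0
  · obtain ⟨g, -, hg⟩ := exists_extension_of_le_sublinear (⊥ : E →ₗ.[ℝ] ℝ) N N_hom N_add (by
      rintro ⟨x, hx⟩
      have hx' : x = 0 := (Submodule.mem_bot ℝ).1 hx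
      subst hx'
      have : (⊥ : E →ₗ.[ℝ] ℝ) ⟨0, hx⟩ = 0 := LinearPMap.map_zero _
      rw [this]
      exact N0.ge)
    exact ⟨g, by rw [h0, map_zero, N0], hg⟩
  · obtain ⟨g, hg1, hg⟩ := exists_extension_of_le_sublinear
      (LinearPMap.mkSpanSingleton x₀ (N x₀) h0) N N_hom N_add (by
      rintro ⟨x, hx⟩
      obtain ⟨r, rfl⟩ := Submodule.mem_span_singleton.1 hx
      have h1 : LinearPMap.mkSpanSingleton x₀ (N x₀) h0 ⟨r • x₀, hx⟩ = r • N x₀ :=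
        LinearPMap.mkSpanSingleton'_apply _ _ _ r hx
      rw [h1]
      change r * N x₀ ≤ N (r • x₀)
      rcases lt_trichotomy r 0 with h | h | h
      · have h1 := N_add (r • x₀) ((-r) • x₀)
        rw [← add_smul, add_neg_cancel, zero_smul, N0, N_hom (-r) (by linarith)] at h1
        linarith
      · rw [h, zero_mul, zero_smul, N0]
      · exact (N_hom r h x₀).ge)
    refine ⟨g, ?_, hg⟩
    exact (hg1 ⟨x₀, Submodule.mem_span_singleton_self x₀⟩).trans
      (LinearPMap.mkSpanSingleton_apply ℝ ℝ h0 (N x₀))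

variable {X : Type*} [MetricSpace X] [MeasurableSpace X] [BorelSpace X]

/-- `π` is a transport plan between `μ` and `ν`. -/
structure IsPlan {X : Type*} [MeasurableSpace X] (μ ν : Measure X) (π : Measure (X × X)) :
    Prop where
  finite : IsFiniteMeasure π
  map_fst : π.map Prod.fst = μ
  map_snd : π.map Prod.snd = ν

lemma IsPlan.integral_fst {μ ν : Measure X} {π : Measure (X × X)} (h : IsPlan μ ν π)
    {f : X → ℝ} (hf : Continuous f) : ∫ p, f p.1 ∂π = ∫ x, f x ∂μ := by
  rw [← h.map_fst, integral_map measurable_fst.aemeasurable hf.aestronglyMeasurable]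

lemma IsPlan.integral_snd {μ ν : Measure X} {π : Measure (X × X)} (h : IsPlan μ ν π)
    {f : X → ℝ} (hf : Continuous f) : ∫ p, f p.2 ∂π = ∫ x, f x ∂ν := by
  rw [← h.map_snd, integral_map measurable_snd.aemeasurable hf.aestronglyMeasurable]

lemma IsPlan.of_integral {μ ν : Measure X} [IsFiniteMeasure μ] [IsFiniteMeasure ν]
    {π : Measure (X × X)} [IsFiniteMeasure π]
    (h1 : ∀ f : C(X, ℝ), ∫ p, f p.1 ∂π = ∫ x, f x ∂μ)
    (h2 : ∀ f : C(X, ℝ), ∫ p, f p.2 ∂π = ∫ x, f x ∂ν) : IsPlan μ ν π := by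
  refine ⟨inferInstance, ?_, ?_⟩
  · refine ext_of_forall_integral_eq_of_IsFiniteMeasure fun f => ?_
    rw [integral_map measurable_fst.aemeasurable f.continuous.aestronglyMeasurable]
    exact h1 f.toContinuousMap
  · refine ext_of_forall_integral_eq_of_IsFiniteMeasure fun f => ?_
    rw [integral_map measurable_snd.aemeasurable f.continuous.aestronglyMeasurable]
    exact h2 f.toContinuousMap

variable [CompactSpace X]

lemma exists_isPlan_of_linear {μ ν : Measure X} [IsFiniteMeasure μ] [IsFiniteMeasure ν]
    (L : C(X × X, ℝ) →ₗ[ℝ] ℝ) (hpos : ∀ h : C(X × X, ℝ), (∀ p, 0 ≤ h p) → 0 ≤ L h)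
    (h1 : ∀ f : C(X, ℝ), L (f.comp .fst) = ∫ x, f x ∂μ)
    (h2 : ∀ f : C(X, ℝ), L (f.comp .snd) = ∫ x, f x ∂ν) :
    ∃ π, IsPlan μ ν π ∧ ∀ h : C(X × X, ℝ), ∫ p, h p ∂π = L h := by
  let Λ : CompactlySupportedContinuousMap (X × X) ℝ →ₚ[ℝ] ℝ :=
  { toFun g := L g.toContinuousMap
    map_add' g g' := L.map_add g.toContinuousMap g'.toContinuousMap
    map_smul' c g := L.map_smul c g.toContinuousMap
    monotone' g g' hgg' := by
      have := hpos (g'.toContinuousMap - g.toContinuousMap) fun p => sub_nonneg.2 (hgg' p)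
      rw [map_sub] at this
      exact sub_nonneg.1 this }
  have key : ∀ h : C(X × X, ℝ), ∫ p, h p ∂(RealRMK.rieszMeasure Λ) = L h := fun h =>
    RealRMK.integral_rieszMeasure Λ (CompactlySupportedContinuousMap.continuousMapEquiv h)
  refine ⟨RealRMK.rieszMeasure Λ, ?_, key⟩
  exact IsPlan.of_integral (fun f => (key (f.comp .fst)).trans (h1 f))
    fun f => (key (f.comp .snd)).trans (h2 f)

/-- Kantorovich duality, with existence of an optimal plan. -/
theorem exists_isPlan_dual [Nonempty X] (μ ν : Measure X) [IsFiniteMeasure μ] [IsFiniteMeasure ν]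
    (hmass : μ univ = ν univ) (c : C(X × X, ℝ)) :
    ∃ π, IsPlan μ ν π ∧ ∀ δ : ℝ, 0 < δ → ∃ f g : C(X, ℝ), (∀ x y, g y - f x ≤ c (x, y)) ∧
      ∫ p, c p ∂π - δ ≤ (∫ x, g x ∂ν) - ∫ x, f x ∂μ := by
  set S : C(X × X, ℝ) → Set ℝ := fun h =>
    {v | ∃ a b : C(X, ℝ), (∀ x y, h (x, y) ≤ a x + b y) ∧ v = (∫ x, a x ∂μ) + ∫ x, b x ∂ν}
    with hS
  have hreal : μ.real univ = ν.real univ := by rw [Measure.real, Measure.real, hmass]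
  have hlow : ∀ (a b : C(X, ℝ)) (r : ℝ), (∀ x y, r ≤ a x + b y) →
      r * μ.real univ ≤ (∫ x, a x ∂μ) + ∫ x, b x ∂ν := by
    intro a b r hr
    obtain ⟨x₀, -, hx₀⟩ := isCompact_univ.exists_isMinOn univ_nonempty
      (a.continuous.continuousOn (s := univ))
    obtain ⟨y₀, -, hy₀⟩ := isCompact_univ.exists_isMinOn univ_nonempty
      (b.continuous.continuousOn (s := univ))
    have h1 : ∫ _, a x₀ ∂μ ≤ ∫ x, a x ∂μ := integral_mono (integrable_const _)
      (integrable_of_continuous _ a.continuous) fun x => hx₀ (mem_univ x)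
    have h2 : ∫ _, b y₀ ∂ν ≤ ∫ x, b x ∂ν := integral_mono (integrable_const _)
      (integrable_of_continuous _ b.continuous) fun x => hy₀ (mem_univ x)
    rw [integral_const, smul_eq_mul] at h1 h2
    rw [← hreal] at h2
    have := mul_le_mul_of_nonneg_right (hr x₀ y₀) (measureReal_nonneg (μ := μ) (s := univ))
    linarith
  have hne : ∀ h, (S h).Nonempty := fun h =>
    ⟨_, ContinuousMap.const X ‖h‖, 0, fun x y => by
      simpa using (le_abs_self _).trans (h.norm_coe_le_norm (x, y)), rfl⟩
  have hbdd : ∀ h, BddBelow (S h) := fun h => by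
    refine ⟨-‖h‖ * μ.real univ, ?_⟩
    rintro v ⟨a, b, hab, rfl⟩
    exact hlow a b _ fun x y =>
      (neg_le_of_abs_le (h.norm_coe_le_norm (x, y))).trans (hab x y)
  have hmem : ∀ h (a b : C(X, ℝ)), (∀ x y, h (x, y) ≤ a x + b y) →
      sInf (S h) ≤ (∫ x, a x ∂μ) + ∫ x, b x ∂ν := fun h a b hab =>
    csInf_le (hbdd h) ⟨a, b, hab, rfl⟩
  have hhom_le : ∀ r : ℝ, 0 < r → ∀ h, sInf (S (r • h)) ≤ r * sInf (S h) := by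
    intro r hr h
    rw [← div_le_iff₀' hr]
    refine le_csInf (hne h) ?_
    rintro v ⟨a, b, hab, rfl⟩
    rw [div_le_iff₀' hr]
    refine (hmem (r • h) (r • a) (r • b) fun x y => ?_).trans_eq ?_
    · have := mul_le_mul_of_nonneg_left (hab x y) hr.le
      simpa [mul_add] using this
    · simp only [ContinuousMap.coe_smul, Pi.smul_apply, smul_eq_mul, integral_const_mul]
      ring
  have hhom : ∀ r : ℝ, 0 < r → ∀ h, sInf (S (r • h)) = r * sInf (S h) := by
    intro r hr h
    refine le_antisymm (hhom_le r hr h) ?_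
    have := hhom_le r⁻¹ (inv_pos.2 hr) (r • h)
    rw [smul_smul, inv_mul_cancel₀ hr.ne', one_smul] at this
    rwa [← le_inv_mul_iff₀ hr]
  have hadd : ∀ h k, sInf (S (h + k)) ≤ sInf (S h) + sInf (S k) := by
    intro h k
    rw [← sub_le_iff_le_add]
    refine le_csInf (hne h) ?_
    rintro v ⟨a, b, hab, rfl⟩
    rw [sub_le_iff_le_add, ← sub_le_iff_le_add']
    refine le_csInf (hne k) ?_
    rintro v ⟨a', b', hab', rfl⟩
    rw [sub_le_iff_le_add']
    refine (hmem (h + k) (a + a') (b + b') fun x y => ?_).trans_eq ?_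
    · have := add_le_add (hab x y) (hab' x y)
      simp only [ContinuousMap.add_apply]
      linarith
    · simp only [ContinuousMap.coe_add, Pi.add_apply]
      rw [integral_add (integrable_of_continuous _ a.continuous)
        (integrable_of_continuous _ a'.continuous),
        integral_add (integrable_of_continuous _ b.continuous)
        (integrable_of_continuous _ b'.continuous)]
      ring
  obtain ⟨L, hL1, hL2⟩ := exists_linear_le_sublinear_eq (fun h => sInf (S h)) hhom hadd (-c)
  obtain ⟨π, hπ, hint⟩ := exists_isPlan_of_linear (μ := μ) (ν := ν) L (fun h hh => by
      have h1 := (hL2 (-h)).trans (hmem (-h) 0 0 fun x y => by simpa using hh (x, y))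
      simpa using h1)
    (fun f => le_antisymm ((hL2 _).trans ((hmem _ f 0 fun x y => by simp).trans_eq (by simp))) (by
      have h1 := (hL2 (-f.comp .fst)).trans (hmem _ (-f) 0 fun x y => by simp)
      rw [map_neg] at h1
      simpa [integral_neg] using h1))
    (fun f => le_antisymm ((hL2 _).trans ((hmem _ 0 f fun x y => by simp).trans_eq (by simp))) (by
      have h1 := (hL2 (-f.comp .snd)).trans (hmem _ 0 (-f) fun x y => by simp)
      rw [map_neg] at h1
      simpa [integral_neg] using h1))
  refine ⟨π, hπ, fun δ hδ => ?_⟩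
  obtain ⟨v, ⟨a, b, hab, rfl⟩, hv⟩ := Real.lt_sInf_add_pos (hne (-c)) hδ
  refine ⟨a, -b, fun x y => ?_, ?_⟩
  · have := hab x y
    simp only [ContinuousMap.neg_apply] at this ⊢
    linarith
  · rw [hint c]
    have h3 : L (-c) = - L c := map_neg L c
    simp only [ContinuousMap.coe_neg, Pi.neg_apply, integral_neg]
    linarith

lemma exists_isPlan_tendsto {μ ν : Measure X} [IsFiniteMeasure μ] [IsFiniteMeasure ν]
    (π : ℕ → Measure (X × X)) (hπ : ∀ n, IsPlan μ ν (π n)) (U : Ultrafilter ℕ) :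
    ∃ π₀, IsPlan μ ν π₀ ∧ ∀ h : C(X × X, ℝ),
      Tendsto (fun n => ∫ p, h p ∂(π n)) U (𝓝 (∫ p, h p ∂π₀)) := by
  have hmass : ∀ n, (π n) univ = μ univ := fun n => by
    rw [← (hπ n).map_fst, Measure.map_apply measurable_fst MeasurableSet.univ, preimage_univ]
  let P : ℕ → FiniteMeasure (X × X) := fun n => ⟨π n, (hπ n).finite⟩
  have hP : ∀ n, (P n).mass = (μ univ).toNNReal := fun n => by
    simp only [P, FiniteMeasure.mass, FiniteMeasure.mk_apply, hmass]
  obtain ⟨π₀, -, hlim⟩ := (isCompact_setOfPred_finiteMeasure_eq_of_compactSpace (X × X)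
    (μ univ).toNNReal).ultrafilter_le_nhds (U.map P) (by
      simp [hP])
  have hlim' : Tendsto P U (𝓝 π₀) := hlim
  rw [FiniteMeasure.tendsto_iff_forall_integral_tendsto] at hlim'
  have key : ∀ h : C(X × X, ℝ),
      Tendsto (fun n => ∫ p, h p ∂(π n)) U (𝓝 (∫ p, h p ∂(π₀ : Measure (X × X)))) := fun h =>
    hlim' (BoundedContinuousFunction.mkOfCompact h)
  refine ⟨π₀, IsPlan.of_integral (fun f => ?_) (fun f => ?_), key⟩
  · refine tendsto_nhds_unique (key (f.comp .fst)) ?_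
    simp only [ContinuousMap.comp_apply, ContinuousMap.fst_apply,
      (hπ _).integral_fst f.continuous, tendsto_const_nhds]
  · refine tendsto_nhds_unique (key (f.comp .snd)) ?_
    simp only [ContinuousMap.comp_apply, ContinuousMap.snd_apply,
      (hπ _).integral_snd f.continuous, tendsto_const_nhds]

end Transport

section Uniqueness

lemma exists_seq_tendsto_ae_zero_of_integral {α : Type*} [MeasurableSpace α] {μ : Measure α}
    {φ : ℕ → α → ℝ} (hint : ∀ n, Integrable (φ n) μ) (hpos : ∀ n x, 0 ≤ φ n x)
    (hlim : Tendsto (fun n => ∫ x, φ n x ∂μ) atTop (𝓝 0)) :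
    ∃ k : ℕ → ℕ, StrictMono k ∧ ∀ᵐ x ∂μ, Tendsto (fun n => φ (k n) x) atTop (𝓝 0) := by
  refine TendstoInMeasure.exists_seq_tendsto_ae (g := fun _ => (0 : ℝ)) ?_
  refine tendstoInMeasure_of_tendsto_eLpNorm (p := 1) one_ne_zero
    (fun n => (hint n).aestronglyMeasurable) aestronglyMeasurable_const ?_
  have h1 : ∀ n, eLpNorm (φ n - fun _ => (0 : ℝ)) 1 μ = ENNReal.ofReal (∫ x, φ n x ∂μ) := by
    intro n
    have h0 : (φ n - fun _ => (0 : ℝ)) = φ n := by ext; simp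
    rw [h0, eLpNorm_one_eq_lintegral_enorm, ← ofReal_integral_norm_eq_lintegral_enorm (hint n)]
    simp only [Real.norm_of_nonneg (hpos n _)]
  simp only [h1]
  simpa using ENNReal.tendsto_ofReal hlim

variable {d : ℕ} {Ω : Set (Euc d)}

/-- The quadratic transport cost. -/
def quadCost (Ω : Set (Euc d)) : C(↥Ω × ↥Ω, ℝ) :=
  ⟨fun p => ‖(p.2 : Euc d) - p.1‖ ^ 2 / 2, by fun_prop⟩

lemma quadCost_apply (x y : Ω) : quadCost Ω (x, y) = ‖(y : Euc d) - x‖ ^ 2 / 2 := rfl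

lemma quadCost_lipschitz {R : ℝ} (hR : ∀ x ∈ Ω, ‖x‖ ≤ R) (x x' y : Ω) :
    quadCost Ω (x, y) ≤ quadCost Ω (x', y) + 2 * R * dist x x' := by
  rw [quadCost_apply, quadCost_apply, Subtype.dist_eq, dist_eq_norm]
  have h1 : ‖(y : Euc d) - x‖ ≤ ‖(y : Euc d) - x'‖ + ‖(x : Euc d) - x'‖ := by
    have : (y : Euc d) - x = (y - x') - (x - x') := by abel
    rw [this]
    exact norm_sub_le _ _
  have h2 : ‖(y : Euc d) - x‖ ≤ 2 * R :=
    (norm_sub_le _ _).trans (by linarith [hR _ x.2, hR _ y.2])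
  have h3 : ‖(y : Euc d) - x'‖ ≤ 2 * R :=
    (norm_sub_le _ _).trans (by linarith [hR _ x'.2, hR _ y.2])
  nlinarith [norm_nonneg ((y : Euc d) - x), norm_nonneg ((y : Euc d) - x'),
    norm_nonneg ((x : Euc d) - x')]

lemma IsPlan.swap {μ ν : Measure Ω} {π : Measure (Ω × Ω)} (h : IsPlan μ ν π) :
    IsPlan ν μ (π.map Prod.swap) := by
  have := h.finite
  refine ⟨inferInstance, ?_, ?_⟩
  · rw [Measure.map_map measurable_fst measurable_swap, ← h.map_snd]
    rfl
  · rw [Measure.map_map measurable_snd measurable_swap, ← h.map_fst]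
    rfl

lemma integral_quadCost_swap (π : Measure (Ω × Ω)) :
    ∫ p, quadCost Ω p ∂(π.map Prod.swap) = ∫ p, quadCost Ω p ∂π := by
  rw [integral_map measurable_swap.aemeasurable (quadCost Ω).continuous.aestronglyMeasurable]
  refine integral_congr_ae (Eventually.of_forall fun p => ?_)
  change ‖(p.1 : Euc d) - p.2‖ ^ 2 / 2 = ‖(p.2 : Euc d) - p.1‖ ^ 2 / 2
  rw [norm_sub_rev]

/-- `π` is an optimal plan for the quadratic cost. -/
def IsOptimalPlan (μ ν : Measure Ω) (π : Measure (Ω × Ω)) : Prop :=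
  IsPlan μ ν π ∧ ∀ π', IsPlan μ ν π' → ∫ p, quadCost Ω p ∂π ≤ ∫ p, quadCost Ω p ∂π'

lemma IsOptimalPlan.swap {μ ν : Measure Ω} {π : Measure (Ω × Ω)} (h : IsOptimalPlan μ ν π) :
    IsOptimalPlan ν μ (π.map Prod.swap) := by
  refine ⟨h.1.swap, fun π' hπ' => ?_⟩
  rw [integral_quadCost_swap, ← integral_quadCost_swap π']
  exact h.2 _ hπ'.swap

variable [CompactSpace Ω] [Nonempty Ω]

lemma exists_dual_lipschitz {R : ℝ} (hR : ∀ x ∈ Ω, ‖x‖ ≤ R) (μ : Measure Ω) [IsFiniteMeasure μ]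
    (f g : C(Ω, ℝ)) (hfg : ∀ x y, g y - f x ≤ quadCost Ω (x, y)) :
    ∃ f' : C(Ω, ℝ), LipschitzWith (2 * R).toNNReal f' ∧
      (∀ x y, g y - f' x ≤ quadCost Ω (x, y)) ∧ ∫ x, f' x ∂μ ≤ ∫ x, f x ∂μ := by
  have hbdd : ∀ x, BddAbove (range fun y => g y - quadCost Ω (x, y)) := fun x =>
    ⟨f x, by rintro _ ⟨y, rfl⟩; linarith [hfg x y]⟩
  have hR0 : 0 ≤ R := by
    obtain ⟨x⟩ := ‹Nonempty Ω›
    exact (norm_nonneg _).trans (hR _ x.2)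
  have hlip : LipschitzWith (2 * R).toNNReal fun x => ⨆ y, (g y - quadCost Ω (x, y)) := by
    refine LipschitzWith.of_le_add_mul _ fun x x' => ?_
    rw [Real.coe_toNNReal _ (by positivity)]
    refine ciSup_le fun y => ?_
    have h1 := le_ciSup (hbdd x') y
    have h2 := quadCost_lipschitz hR x' x y
    rw [dist_comm] at h2
    linarith
  refine ⟨⟨_, hlip.continuous⟩, hlip, fun x y => ?_, ?_⟩
  · have h1 := le_ciSup (hbdd x) y
    simp only [ContinuousMap.coe_mk] at h1 ⊢
    linarith
  · refine integral_mono (integrable_of_continuous _ hlip.continuous)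
      (integrable_of_continuous _ f.continuous) fun x => ciSup_le fun y => ?_
    linarith [hfg x y]

lemma exists_potential {μ ν : Measure Ω} [IsFiniteMeasure μ] [IsFiniteMeasure ν]
    (hmass : μ univ = ν univ) {π π' : Measure (Ω × Ω)} (hπ : IsOptimalPlan μ ν π)
    (hπ' : IsOptimalPlan μ ν π') :
    ∃ (K : ℝ≥0) (f : Ω → ℝ), LipschitzWith K f ∧ ∀ᵐ p ∂(π + π'), ∀ z,
      f p.1 + quadCost Ω p ≤ f z + quadCost Ω (z, p.2) := by
  have := hπ.1.finite
  have := hπ'.1.finite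
  obtain ⟨R, hR⟩ := (isCompact_iff_compactSpace.2 ‹CompactSpace Ω›).isBounded.exists_norm_le
  obtain ⟨π₀, hπ₀, hdual⟩ := exists_isPlan_dual μ ν hmass (quadCost Ω)
  have hseq : ∀ n : ℕ, ∃ f g : C(Ω, ℝ), LipschitzWith (2 * R).toNNReal f ∧
      (∀ x y, g y - f x ≤ quadCost Ω (x, y)) ∧
      ∫ p, quadCost Ω p ∂π₀ - 1 / ((n : ℝ) + 1) ≤ (∫ x, g x ∂ν) - ∫ x, f x ∂μ := by
    intro n
    obtain ⟨f, g, hfg, h⟩ := hdual (1 / ((n : ℝ) + 1)) (by positivity)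
    obtain ⟨f', h1, h2, h3⟩ := exists_dual_lipschitz hR μ f g hfg
    exact ⟨f', g, h1, h2, by linarith⟩
  choose f g hlip hfg hval using hseq
  set φ : ℕ → Ω × Ω → ℝ := fun n p => quadCost Ω p - (g n p.2 - f n p.1) with hφ
  have hφc : ∀ n, Continuous (φ n) := fun n => by fun_prop
  have hφ0 : ∀ n p, 0 ≤ φ n p := fun n p => sub_nonneg.2 (hfg n p.1 p.2)
  have hφint : ∀ π₁, IsOptimalPlan μ ν π₁ → ∀ n, ∫ p, φ n p ∂π₁ ≤ 1 / ((n : ℝ) + 1) := by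
    intro π₁ h n
    have := h.1.finite
    have h1 : ∫ p, φ n p ∂π₁ = ∫ p, quadCost Ω p ∂π₁ - ((∫ x, g n x ∂ν) - ∫ x, f n x ∂μ) := by
      rw [integral_sub (integrable_of_continuous _ (by fun_prop))
        (integrable_of_continuous _ (by fun_prop)),
        integral_sub (integrable_of_continuous _ (by fun_prop))
        (integrable_of_continuous _ (by fun_prop)), h.1.integral_fst (f n).continuous,
        h.1.integral_snd (g n).continuous]
    have := h.2 π₀ hπ₀
    have := hval n
    linarith
  obtain ⟨k, -, hk⟩ := exists_seq_tendsto_ae_zero_of_integral (μ := π + π') (φ := φ)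
    (fun n => integrable_of_continuous _ (hφc n)) hφ0 (by
      have h0 : Tendsto (fun n : ℕ => 2 * (1 / ((n : ℝ) + 1))) atTop (𝓝 0) := by
        simpa using tendsto_one_div_add_atTop_nhds_zero_nat.const_mul (2 : ℝ)
      refine squeeze_zero (fun n => integral_nonneg (hφ0 n)) (fun n => ?_) h0
      rw [integral_add_measure (integrable_of_continuous _ (hφc n))
        (integrable_of_continuous _ (hφc n))]
      linarith [hφint π hπ n, hφint π' hπ' n])
  obtain ⟨x₀⟩ := ‹Nonempty Ω›
  let U : Ultrafilter ℕ := hyperfilter ℕ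
  have hU : (U : Filter ℕ) ≤ atTop := Nat.hyperfilter_le_atTop
  have hex : ∀ z, ∃ l, Tendsto (fun n => f (k n) z - f (k n) x₀) U (𝓝 l) := by
    intro z
    obtain ⟨l, -, hl⟩ := (isCompact_Icc (a := -((2 * R).toNNReal * dist z x₀))
      (b := (2 * R).toNNReal * dist z x₀)).ultrafilter_le_nhds
      (U.map fun n => f (k n) z - f (k n) x₀) (by
        rw [le_principal_iff]
        refine Eventually.of_forall (f := (U : Filter ℕ)) fun n => ?_
        have := (hlip (k n)).dist_le_mul z x₀
        rw [Real.dist_eq] at this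
        exact abs_le.1 this)
    exact ⟨l, hl⟩
  choose F hF using hex
  refine ⟨(2 * R).toNNReal, F, LipschitzWith.of_le_add_mul _ fun x y => ?_, ?_⟩
  · refine le_of_tendsto_of_tendsto (hF x) ((hF y).add_const _) (Eventually.of_forall fun n => ?_)
    have := (abs_le.1 ((hlip (k n)).dist_le_mul x y)).2
    simp only
    linarith
  · filter_upwards [hk] with p hp z
    have h1 : Tendsto (fun n => f (k n) z - f (k n) x₀ - (f (k n) p.1 - f (k n) x₀)
        + quadCost Ω (z, p.2) - quadCost Ω p + φ (k n) p) U
        (𝓝 (F z - F p.1 + quadCost Ω (z, p.2) - quadCost Ω p + 0)) :=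
      ((((hF z).sub (hF p.1)).add_const _).sub_const _).add (hp.mono_left hU)
    have h2 := ge_of_tendsto (b := 0) h1 (Eventually.of_forall fun n => by
      have := hφ0 (k n) (z, p.2)
      simp only [hφ] at this ⊢
      linarith)
    linarith

lemma eq_add_gradient_of_min {F : Euc d → ℝ} {x y : Euc d} (hF : DifferentiableAt ℝ F x)
    (hmin : IsLocalMin (fun z => F z + ‖y - z‖ ^ 2 / 2) x) : y = x + gradient F x := by
  have h1 : HasFDerivAt (fun z : Euc d => ‖y - z‖ ^ 2 / 2)
      ((1 / 2 : ℝ) • ((2 : ℝ) • (innerSL ℝ (y - x)).comp (-ContinuousLinearMap.id ℝ (Euc d)))) x := by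
    have h := ((hasFDerivAt_id x).const_sub y).norm_sq.const_mul (1 / 2 : ℝ)
    refine (h.congr_of_eventuallyEq (Eventually.of_forall fun z => ?_)).congr_fderiv ?_
    · simp; ring
    · ext v; simp
  have h2 := hmin.hasFDerivAt_eq_zero (hF.hasFDerivAt.add h1)
  have h3 : gradient F x - (y - x) = 0 := by
    refine ext_inner_right ℝ fun v => ?_
    have h4 := congrArg (fun L : Euc d →L[ℝ] ℝ => L v) h2
    simp only [add_apply, smul_apply,
      ContinuousLinearMap.comp_apply, neg_apply, ContinuousLinearMap.id_apply,
      innerSL_apply_apply, inner_neg_right, smul_eq_mul, zero_apply] at h4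
    rw [inner_sub_left, inner_zero_left, gradient, InnerProductSpace.toDual_symm_apply]
    linarith
  rw [sub_eq_zero] at h3
  rw [h3]
  abel

lemma measurable_gradient (F : Euc d → ℝ) : Measurable (gradient F) :=
  (LinearIsometryEquiv.continuous _).measurable.comp (measurable_fderiv ℝ F)

theorem IsOptimalPlan.unique (hΩ : IsCompact Ω) (hconv : Convex ℝ Ω)
    {μ ν : Measure Ω} [IsFiniteMeasure μ] [IsFiniteMeasure ν]
    (hmass : μ univ = ν univ) (hac : μ.map Subtype.val ≪ (volume : Measure (Euc d)))
    {π π' : Measure (Ω × Ω)} (hπ : IsOptimalPlan μ ν π) (hπ' : IsOptimalPlan μ ν π') :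
    π = π' := by
  obtain ⟨K, f, hlip, hf⟩ := exists_potential hmass hπ hπ'
  classical
  obtain ⟨F, hFlip, hFeq⟩ := LipschitzOnWith.extend_real (K := K) (s := Ω)
    (f := fun x => if h : x ∈ Ω then f ⟨x, h⟩ else 0) (by
      intro x hx y hy
      simp only [hx, hy, dif_pos]
      exact hlip ⟨x, hx⟩ ⟨y, hy⟩)
  have hFf : ∀ x : Ω, F x = f x := fun x => by
    rw [← hFeq x.2]
    simp
  have hreg : ∀ᵐ x : Ω ∂μ, DifferentiableAt ℝ F (x : Euc d) ∧ (x : Euc d) ∈ interior Ω := by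
    have h1 : ∀ᵐ x ∂(volume : Measure (Euc d)), DifferentiableAt ℝ F x ∧ x ∉ frontier Ω :=
      hFlip.ae_differentiableAt.and (measure_eq_zero_iff_ae_notMem.1 (hconv.addHaar_frontier _))
    filter_upwards [ae_of_ae_map measurable_subtype_coe.aemeasurable (hac.ae_le h1)] with x hx
    refine ⟨hx.1, ?_⟩
    by_contra h
    exact hx.2 ⟨subset_closure x.2, h⟩
  set T : Euc d → Euc d := fun x => x + gradient F x with hT
  have hTm : Measurable T := measurable_id.add (measurable_gradient F)
  have hgraph : ∀ᵐ p ∂(π + π'), DifferentiableAt ℝ F p.1 ∧ (p.1 : Euc d) ∈ interior Ω →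
      (p.2 : Euc d) = T p.1 := by
    filter_upwards [hf] with p hp hr
    refine eq_add_gradient_of_min hr.1 ?_
    filter_upwards [isOpen_interior.mem_nhds hr.2] with z hz
    have := hp ⟨z, interior_subset hz⟩
    rw [← hFf, ← hFf] at this
    exact this
  have hmap : ∀ π₁, IsPlan μ ν π₁ → (∀ᵐ p ∂π₁, DifferentiableAt ℝ F p.1 ∧
      (p.1 : Euc d) ∈ interior Ω → (p.2 : Euc d) = T p.1) →
      π₁.map (Prod.map id Subtype.val) = μ.map fun x : Ω => (x, T x) := by
    intro π₁ h1 h2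
    have h3 : ∀ᵐ p ∂π₁, DifferentiableAt ℝ F p.1 ∧ (p.1 : Euc d) ∈ interior Ω := by
      rw [← h1.map_fst] at hreg
      exact ae_of_ae_map measurable_fst.aemeasurable hreg
    have h4 : (Prod.map id Subtype.val : Ω × Ω → Ω × Euc d)
        =ᵐ[π₁] (fun x : Ω => (x, T x)) ∘ Prod.fst := by
      filter_upwards [h2, h3] with p hp hp'
      exact Prod.ext rfl (hp hp')
    rw [Measure.map_congr h4, ← Measure.map_map (by fun_prop) measurable_fst, h1.map_fst]
  rw [ae_add_measure_iff] at hgraph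
  have hemb : MeasurableEmbedding (Prod.map id Subtype.val : Ω × Ω → Ω × Euc d) :=
    MeasurableEmbedding.id.prodMap (MeasurableEmbedding.subtype_coe hΩ.measurableSet)
  rw [← hemb.comap_map π, ← hemb.comap_map π', hmap π hπ.1 hgraph.1, hmap π' hπ'.1 hgraph.2]

theorem IsOptimalPlan.unique_of_or (hΩ : IsCompact Ω) (hconv : Convex ℝ Ω)
    {μ ν : Measure Ω} [IsFiniteMeasure μ] [IsFiniteMeasure ν]
    (hmass : μ univ = ν univ) (hac : μ.map Subtype.val ≪ (volume : Measure (Euc d)) ∨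
      ν.map Subtype.val ≪ (volume : Measure (Euc d)))
    {π π' : Measure (Ω × Ω)} (hπ : IsOptimalPlan μ ν π) (hπ' : IsOptimalPlan μ ν π') :
    π = π' := by
  rcases hac with hac | hac
  · exact hπ.unique hΩ hconv hmass hac hπ'
  · have h := hπ.swap.unique hΩ hconv hmass.symm hac hπ'.swap
    have h1 : ∀ π₁ : Measure (Ω × Ω), (π₁.map Prod.swap).map Prod.swap = π₁ := fun π₁ => by
      rw [Measure.map_map measurable_swap measurable_swap, Prod.swap_swap_eq, Measure.map_id]
    rw [← h1 π, h, h1]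

end Uniqueness

section ExpSlope

/-- The entire function `w ↦ (exp w - 1) / w`. -/
def expSlope (w : ℝ) : ℝ := dslope Real.exp 0 w

lemma mul_expSlope (w : ℝ) : w * expSlope w = Real.exp w - 1 := by
  have := sub_smul_dslope Real.exp 0 w
  simpa [expSlope] using this

lemma contDiff_expSlope : ContDiff ℝ 2 expSlope := by
  rw [contDiff_iff_contDiffAt]
  intro w
  by_cases hw : w = 0
  · subst hw
    obtain ⟨p, hp⟩ := (analyticAt_rexp (x := 0))
    exact hp.has_fpower_series_dslope_fslope.analyticAt.contDiffAt
  · have h1 : ContDiffAt ℝ 2 (fun w => (Real.exp w - 1) / w) w :=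
      (Real.contDiff_exp.contDiffAt.sub contDiffAt_const).div contDiffAt_id hw
    refine h1.congr_of_eventuallyEq ?_
    filter_upwards [isOpen_ne.mem_nhds hw] with v hv
    rw [eq_div_iff hv, ← mul_expSlope, mul_comm]

lemma continuous_expSlope : Continuous expSlope := contDiff_expSlope.continuous

lemma hasDerivAt_expSlope (w : ℝ) : HasDerivAt expSlope (deriv expSlope w) w :=
  (contDiff_expSlope.differentiable (by norm_num) w).hasDerivAt

lemma continuous_deriv_expSlope : Continuous (deriv expSlope) :=
  contDiff_expSlope.continuous_deriv (by norm_num)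

lemma expSlope_add_mul_deriv (w : ℝ) : expSlope w + w * deriv expSlope w = Real.exp w := by
  have h1 := (hasDerivAt_id w).mul (hasDerivAt_expSlope w)
  have h2 : (id * expSlope) = fun w => Real.exp w - 1 := funext mul_expSlope
  rw [h2] at h1
  have := h1.unique ((Real.hasDerivAt_exp w).sub_const 1)
  simpa using this

end ExpSlope

section SoftMin

variable {d : ℕ}

/-- The Hamilton-Jacobi expression `∂ₜφ + |∇φ|²/2`. -/
def hjExpr (φ : ℝ × Euc d → ℝ) (p : ℝ × Euc d) : ℝ :=
  fderiv ℝ φ p (1, 0) + (∑ i, fderiv ℝ φ p (0, EuclideanSpace.single i 1) ^ 2) / 2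

lemma exists_softmin {ι : Type*} {F : Finset ι} (hF : F.Nonempty) {h : ι → ℝ × Euc d → ℝ}
    (hh : ∀ z, ContDiff ℝ 1 (h z)) {δ : ℝ} (hδ : 0 < δ) :
    ∃ φ : ℝ × Euc d → ℝ, ContDiff ℝ 1 φ ∧ (∀ z ∈ F, ∀ p, φ p ≤ h z p) ∧
      (∀ p c, (∀ z ∈ F, c ≤ h z p) → c - δ ≤ φ p) ∧
      ∀ p κ, (∀ z ∈ F, hjExpr (h z) p ≤ κ) → hjExpr φ p ≤ κ := by
  obtain ⟨θ, hθ, hθδ⟩ : ∃ θ : ℝ, 0 < θ ∧ θ * Real.log F.card ≤ δ := by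
    have hl : 0 ≤ Real.log F.card := Real.log_natCast_nonneg _
    refine ⟨δ / (Real.log F.card + 1), by positivity, ?_⟩
    rw [div_mul_eq_mul_div, div_le_iff₀ (by positivity)]
    nlinarith
  set S : ℝ × Euc d → ℝ := fun p => ∑ z ∈ F, Real.exp (-(h z p) / θ) with hS
  have hSpos : ∀ p, 0 < S p := fun p => Finset.sum_pos (fun z _ => Real.exp_pos _) hF
  have hSc : ContDiff ℝ 1 S := by
    refine ContDiff.sum fun z _ => Real.contDiff_exp.comp (((hh z).neg).div_const _)
  refine ⟨fun p => -θ * Real.log (S p), contDiff_const.mul (hSc.log fun p => (hSpos p).ne'),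
    fun z hz p => ?_, fun p c hc => ?_, fun p κ hκ => ?_⟩
  · have h1 : Real.exp (-(h z p) / θ) ≤ S p :=
      Finset.single_le_sum (f := fun z => Real.exp (-(h z p) / θ))
        (fun z _ => (Real.exp_pos _).le) hz
    have h2 := (Real.le_log_iff_exp_le (hSpos p)).2 h1
    rw [div_le_iff₀ hθ] at h2
    linarith
  · have h1 : S p ≤ F.card * Real.exp (-c / θ) := by
      rw [← nsmul_eq_mul]
      refine Finset.sum_le_card_nsmul _ _ _ fun z hz => Real.exp_le_exp.2 ?_
      have := hc z hz
      gcongr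
    have h2 := Real.log_le_log (hSpos p) h1
    have hcard : (0 : ℝ) < F.card := by exact_mod_cast hF.card_pos
    rw [Real.log_mul hcard.ne' (Real.exp_pos _).ne', Real.log_exp] at h2
    have h3 := mul_le_mul_of_nonneg_left h2 hθ.le
    have h4 : θ * (-c / θ) = -c := by field_simp
    rw [mul_add, h4] at h3
    linarith
  · set w : ι → ℝ := fun z => Real.exp (-(h z p) / θ) / S p with hw
    have hw0 : ∀ z ∈ F, 0 ≤ w z := fun z _ => div_nonneg (Real.exp_pos _).le (hSpos p).le
    have hw1 : ∑ z ∈ F, w z = 1 := by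
      rw [hw, ← Finset.sum_div, div_self (hSpos p).ne']
    have hd : HasFDerivAt (fun p => -θ * Real.log (S p)) (∑ z ∈ F, w z • fderiv ℝ (h z) p) p := by
      have h1 : HasFDerivAt S
          (∑ z ∈ F, Real.exp (-(h z p) / θ) • ((-θ⁻¹) • fderiv ℝ (h z) p)) p := by
        refine HasFDerivAt.fun_sum fun z _ => HasFDerivAt.exp ?_
        have h2 := (((hh z).differentiable (by norm_num) p).hasFDerivAt).const_mul (-θ⁻¹)
        refine h2.congr_of_eventuallyEq (Eventually.of_forall fun q => ?_)
        simp only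
        ring
      refine ((h1.log (hSpos p).ne').const_mul (-θ)).congr_fderiv ?_
      rw [Finset.smul_sum, Finset.smul_sum]
      refine Finset.sum_congr rfl fun z _ => ?_
      rw [smul_smul, smul_smul, smul_smul]
      congr 1
      simp only [hw]
      field_simp
    have hda : ∀ v, fderiv ℝ (fun p => -θ * Real.log (S p)) p v
        = ∑ z ∈ F, w z * fderiv ℝ (h z) p v := fun v => by
      rw [hd.fderiv]
      simp
    have hsq : ∀ v, (∑ z ∈ F, w z * fderiv ℝ (h z) p v) ^ 2
        ≤ ∑ z ∈ F, w z * fderiv ℝ (h z) p v ^ 2 := fun v => by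
      have := (even_two.convexOn_pow (𝕜 := ℝ)).map_sum_le hw0 hw1
        (p := fun z => fderiv ℝ (h z) p v) (fun _ _ => mem_univ _)
      simpa using this
    calc hjExpr (fun p => -θ * Real.log (S p)) p
        ≤ ∑ z ∈ F, w z * fderiv ℝ (h z) p (1, 0)
          + (∑ i, ∑ z ∈ F, w z * fderiv ℝ (h z) p (0, EuclideanSpace.single i 1) ^ 2) / 2 := by
          simp only [hjExpr, hda]
          gcongr with i
          exact hsq _
      _ = ∑ z ∈ F, w z * hjExpr (h z) p := by
          rw [Finset.sum_comm, Finset.sum_div, ← Finset.sum_add_distrib]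
          refine Finset.sum_congr rfl fun z _ => ?_
          rw [hjExpr, ← Finset.mul_sum]
          ring
      _ ≤ ∑ z ∈ F, w z * κ :=
          Finset.sum_le_sum fun z hz => mul_le_mul_of_nonneg_left (hκ z hz) (hw0 z hz)
      _ = κ := by rw [← Finset.sum_mul, hw1, one_mul]

end SoftMin

section HopfLax

/-- A smooth positive function of time which equals `t + τ` on a neighbourhood of `[0, ∞)`. -/
def shiftedTime (τ t : ℝ) : ℝ :=
  Real.smoothTransition ((t + τ / 2) * (4 / τ)) * (t + τ - 1) + 1

lemma contDiff_shiftedTime (τ : ℝ) : ContDiff ℝ 1 (shiftedTime τ) := by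
  unfold shiftedTime
  have : ContDiff ℝ 1 Real.smoothTransition := Real.smoothTransition.contDiff
  fun_prop

lemma shiftedTime_pos {τ : ℝ} (hτ : 0 < τ) (t : ℝ) : 0 < shiftedTime τ t := by
  unfold shiftedTime
  rcases le_or_gt t (-τ / 2) with h | h
  · rw [Real.smoothTransition.zero_of_nonpos
      (mul_nonpos_of_nonpos_of_nonneg (by linarith) (by positivity))]
    simp
  · have h0 := Real.smoothTransition.nonneg ((t + τ / 2) * (4 / τ))
    have h1 := Real.smoothTransition.le_one ((t + τ / 2) * (4 / τ))
    rcases le_total 1 (t + τ) with h2 | h2 <;> nlinarith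

lemma shiftedTime_eq {τ t : ℝ} (hτ : 0 < τ) (ht : -τ / 4 ≤ t) : shiftedTime τ t = t + τ := by
  unfold shiftedTime
  rw [Real.smoothTransition.one_of_one_le]
  · ring
  · rw [mul_div_assoc', le_div_iff₀ hτ]
    linarith

lemma hasDerivAt_shiftedTime {τ t : ℝ} (hτ : 0 < τ) (ht : 0 ≤ t) :
    HasDerivAt (shiftedTime τ) 1 t := by
  refine ((hasDerivAt_id t).add_const τ).congr_of_eventuallyEq ?_
  filter_upwards [lt_mem_nhds (show -τ / 4 < t by linarith)] with r hr
  exact shiftedTime_eq hτ hr.le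

variable {d : ℕ}

/-- The integral of `exp (α s + ⟪ξ, ·⟫)` along the segment from `(-τ, z)` to `(t, x)`, where `s`
stands for the duration `t + τ`, plus the cost of that segment. -/
def perturbedCost (α : ℝ) (ξ : Euc d) (η τ s : ℝ) (z x : Euc d) : ℝ :=
  ‖x - z‖ ^ 2 / (2 * s) +
    η * (s * Real.exp (inner ℝ ξ z - α * τ) * expSlope (α * s + inner ℝ ξ (x - z)))

lemma contDiff_perturbedCost (α : ℝ) (ξ : Euc d) (η : ℝ) {τ : ℝ} (hτ : 0 < τ) (z : Euc d) :
    ContDiff ℝ 1 fun p : ℝ × Euc d => perturbedCost α ξ η τ (shiftedTime τ p.1) z p.2 := by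
  unfold perturbedCost
  have h1 : ContDiff ℝ 1 fun p : ℝ × Euc d => shiftedTime τ p.1 :=
    (contDiff_shiftedTime τ).comp contDiff_fst
  have h2 : ContDiff ℝ 1 expSlope := contDiff_expSlope.of_le (by norm_num)
  have h3 : ContDiff ℝ 1 fun p : ℝ × Euc d => p.2 - z := contDiff_snd.sub contDiff_const
  refine ContDiff.add ?_ (contDiff_const.mul ?_)
  · exact (h3.norm_sq ℝ).div (contDiff_const.mul h1)
      fun p => mul_ne_zero two_ne_zero (shiftedTime_pos hτ _).ne'
  · exact (h1.mul contDiff_const).mul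
      (h2.comp ((contDiff_const.mul h1).add (contDiff_const.inner ℝ h3)))

lemma fderiv_perturbedCost (α : ℝ) (ξ : Euc d) (η : ℝ) {τ : ℝ} (hτ : 0 < τ) (z x : Euc d)
    {t : ℝ} (ht : 0 ≤ t) (a : ℝ) (v : Euc d) :
    fderiv ℝ (fun p : ℝ × Euc d => perturbedCost α ξ η τ (shiftedTime τ p.1) z p.2) (t, x) (a, v)
      = -‖x - z‖ ^ 2 * a / (2 * (t + τ) ^ 2) + inner ℝ (x - z) v / (t + τ)
        + η * (Real.exp (inner ℝ ξ z - α * τ) *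
          (a * expSlope (α * (t + τ) + inner ℝ ξ (x - z)) + (t + τ) *
            (deriv expSlope (α * (t + τ) + inner ℝ ξ (x - z)) * (α * a + inner ℝ ξ v)))) := by
  have hs : t + τ ≠ 0 := by positivity
  have hs2 : shiftedTime τ t = t + τ := shiftedTime_eq hτ (by linarith)
  have hdiff := ((contDiff_perturbedCost α ξ η hτ z).differentiable (by norm_num)
    (t, x)).hasFDerivAt
  have hline : HasDerivAt (fun r : ℝ => ((t, x) : ℝ × Euc d) + r • (a, v)) (a, v) 0 := by
    simpa using ((hasDerivAt_id (0 : ℝ)).smul_const ((a, v) : ℝ × Euc d)).const_add (t, x)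
  have h1 := HasFDerivAt.comp_hasDerivAt (0 : ℝ) (by simpa using hdiff) hline
  refine h1.unique ?_
  have hS : HasDerivAt (fun r : ℝ => shiftedTime τ (t + r * a)) a 0 := by
    have h2 : HasDerivAt (fun r : ℝ => t + r * a) a 0 := by
      simpa using ((hasDerivAt_id (0 : ℝ)).mul_const a).const_add t
    have h3 := HasDerivAt.comp (0 : ℝ) (h₂ := shiftedTime τ) (h₂' := 1)
      (by simpa using hasDerivAt_shiftedTime hτ ht) h2
    simpa [Function.comp_def] using h3
  have hX : HasDerivAt (fun r : ℝ => x + r • v - z) v 0 := by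
    simpa using (((hasDerivAt_id (0 : ℝ)).smul_const v).const_add x).sub_const z
  have hN : HasDerivAt (fun r : ℝ => ‖x + r • v - z‖ ^ 2) (2 * inner ℝ (x - z) v) 0 := by
    simpa using hX.norm_sq
  have hI : HasDerivAt (fun r : ℝ => inner ℝ ξ (x + r • v - z)) (inner ℝ ξ v) 0 := by
    simpa using (hasDerivAt_const (0 : ℝ) ξ).inner ℝ hX
  have hE := HasDerivAt.comp (0 : ℝ) (h₂ := expSlope)
    (h := fun r : ℝ => α * shiftedTime τ (t + r * a) + inner ℝ ξ (x + r • v - z))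
    (hasDerivAt_expSlope _) ((hS.const_mul α).add hI)
  have h4 := (hN.div (hS.const_mul 2) (by simp [hs2, hs])).add
    (((hS.mul_const (Real.exp (inner ℝ ξ z - α * τ))).mul hE).const_mul η)
  refine (h4.congr_of_eventuallyEq (Eventually.of_forall fun r => ?_)).congr_deriv ?_
  · simp [perturbedCost]
  · simp only [Function.comp, zero_mul, zero_smul, add_zero, hs2]
    field_simp
    ring

lemma hjExpr_perturbedCost (α : ℝ) (ξ : Euc d) (η : ℝ) {τ : ℝ} (hτ : 0 < τ) (z x : Euc d)
    {t : ℝ} (ht : 0 ≤ t) :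
    hjExpr (fun p : ℝ × Euc d => perturbedCost α ξ η τ (shiftedTime τ p.1) z p.2) (t, x)
      = η * Real.exp (α * t + inner ℝ ξ x) + η ^ 2 * (((t + τ) * (Real.exp (inner ℝ ξ z - α * τ) *
        deriv expSlope (α * (t + τ) + inner ℝ ξ (x - z)))) ^ 2 * ‖ξ‖ ^ 2 / 2) := by
  have hs : t + τ ≠ 0 := by positivity
  have hin : ∀ (u : Euc d) i, inner ℝ u (EuclideanSpace.single i (1 : ℝ)) = u i := fun u i => by
    simp [EuclideanSpace.inner_single_right]
  have hexp : Real.exp (α * t + inner ℝ ξ x) = Real.exp (inner ℝ ξ z - α * τ) *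
      (expSlope (α * (t + τ) + inner ℝ ξ (x - z)) + (α * (t + τ) + inner ℝ ξ (x - z)) *
        deriv expSlope (α * (t + τ) + inner ℝ ξ (x - z))) := by
    rw [expSlope_add_mul_deriv, ← Real.exp_add, inner_sub_right]
    congr 1
    ring
  set w := α * (t + τ) + inner ℝ ξ (x - z) with hw
  set A := Real.exp (inner ℝ ξ z - α * τ)
  set D := deriv expSlope w
  have h1 : inner ℝ ξ (x - z) = ∑ i, (x - z) i * ξ i := by
    simp [PiLp.inner_apply]
  have hsum : ∑ i, ((x - z) i / (t + τ) + η * (A * ((t + τ) * (D * ξ i)))) ^ 2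
      = ‖x - z‖ ^ 2 / (t + τ) ^ 2 + 2 * η * A * D * inner ℝ ξ (x - z)
        + η ^ 2 * ((t + τ) * (A * D)) ^ 2 * ‖ξ‖ ^ 2 := by
    rw [h1, EuclideanSpace.real_norm_sq_eq, EuclideanSpace.real_norm_sq_eq, Finset.sum_div,
      Finset.mul_sum, Finset.mul_sum, ← Finset.sum_add_distrib, ← Finset.sum_add_distrib]
    refine Finset.sum_congr rfl fun i _ => ?_
    field_simp
    ring
  rw [hjExpr, fderiv_perturbedCost α ξ η hτ z x ht]
  simp only [fderiv_perturbedCost α ξ η hτ z x ht, hin, inner_zero_right, mul_zero, zero_mul,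
    zero_div, zero_add, add_zero, mul_one]
  simp only [← hw]
  rw [hsum, hexp, eq_sub_of_add_eq' hw.symm]
  change -‖x - z‖ ^ 2 / (2 * (t + τ) ^ 2) + η * (A * (1 * expSlope w + (t + τ) * (D * α))) + _ = _
  field_simp
  ring

end HopfLax

section WeakDuality

variable {d : ℕ} {Ω : Set (Euc d)}

/-- The space-time exponential `(t, x) ↦ exp (α t + ⟪ξ, x⟫)`. -/
def stExp (Ω : Set (Euc d)) (α : ℝ) (ξ : Euc d) : C(STt d Ω, ℝ) :=
  ⟨fun p => Real.exp (α * (p.1 : ℝ) + inner ℝ ξ (p.2 : Euc d)), by fun_prop⟩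

/-- The integral of a space-time exponential along the constant-speed segment from `x` to `y`. -/
def segExp (Ω : Set (Euc d)) (α : ℝ) (ξ : Euc d) : C(Ω × Ω, ℝ) :=
  ⟨fun p => Real.exp (inner ℝ ξ (p.1 : Euc d)) * expSlope (α + inner ℝ ξ ((p.2 : Euc d) - p.1)),
    by
      have := continuous_expSlope
      fun_prop⟩

lemma exists_bound_hjError [CompactSpace Ω] (α : ℝ) (ξ : Euc d) :
    ∃ C, ∀ τ ∈ Icc (0:ℝ) 1, ∀ t ∈ Icc (0:ℝ) 1, ∀ z x : Ω,
      ((t + τ) * (Real.exp (inner ℝ ξ (z : Euc d) - α * τ) *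
        deriv expSlope (α * (t + τ) + inner ℝ ξ ((x : Euc d) - z)))) ^ 2 * ‖ξ‖ ^ 2 / 2 ≤ C := by
  have h1 : Continuous fun q : (Icc (0:ℝ) 1 × Icc (0:ℝ) 1) × (Ω × Ω) =>
      (((q.1.2 : ℝ) + q.1.1) * (Real.exp (inner ℝ ξ (q.2.1 : Euc d) - α * q.1.1) *
        deriv expSlope (α * ((q.1.2 : ℝ) + q.1.1) + inner ℝ ξ ((q.2.2 : Euc d) - q.2.1)))) ^ 2
        * ‖ξ‖ ^ 2 / 2 := by
    have := continuous_deriv_expSlope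
    fun_prop
  obtain ⟨C, hC⟩ := (isCompact_range h1).bddAbove
  exact ⟨C, fun τ hτ t ht z x => hC ⟨((⟨τ, hτ⟩, ⟨t, ht⟩), (z, x)), rfl⟩⟩

lemma exists_subsolution [CompactSpace Ω] [Nonempty Ω] (α : ℝ) (ξ : Euc d) :
    ∃ C, ∀ (η : ℝ) (f g : C(Ω, ℝ)),
      (∀ x y, g y - f x ≤ quadCost Ω (x, y) + η * segExp Ω α ξ (x, y)) → ∀ δ > 0,
      ∃ φ : ℝ × Euc d → ℝ, ContDiff ℝ 1 φ ∧ (∀ x : Ω, φ (0, x) ≤ f x + δ) ∧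
        (∀ y : Ω, g y - δ ≤ φ (1, y)) ∧
        ∀ p : STt d Ω, hjExpr φ (STemb p) ≤ η * stExp Ω α ξ p + C * η ^ 2 := by
  obtain ⟨C, hC⟩ := exists_bound_hjError (Ω := Ω) α ξ
  refine ⟨C, fun η f g hfg δ hδ => ?_⟩
  have hE := continuous_expSlope
  have hend : ∀ᶠ τ in 𝓝 (0 : ℝ), ∀ q ∈ (univ : Set (Ω × Ω)),
      g q.2 - δ / 2 < f q.1 + perturbedCost α ξ η τ (1 + τ) q.1 q.2 := by
    refine isCompact_univ.eventually_forall_of_forall_eventually fun q _ => ?_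
    refine ContinuousAt.eventually_lt (f := fun r : ℝ × (Ω × Ω) => g r.2.2 - δ / 2)
      (g := fun r : ℝ × (Ω × Ω) => f r.2.1 + perturbedCost α ξ η r.1 (1 + r.1) r.2.1 r.2.2)
      (by fun_prop) ?_ ?_
    · unfold perturbedCost
      refine ContinuousAt.add (by fun_prop) (ContinuousAt.add (ContinuousAt.div (by fun_prop)
        (by fun_prop) (by norm_num)) (by fun_prop))
    · have h := hfg q.1 q.2
      rw [quadCost_apply] at h
      change _ ≤ _ + η * (Real.exp _ * expSlope _) at h
      simp only [perturbedCost, add_zero, mul_one, mul_zero, sub_zero, one_mul]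
      linarith
  have hstart : ∀ᶠ τ in 𝓝 (0 : ℝ), ∀ z ∈ (univ : Set Ω), perturbedCost α ξ η τ τ z z < δ := by
    refine isCompact_univ.eventually_forall_of_forall_eventually fun z _ => ?_
    refine ContinuousAt.eventually_lt
      (f := fun r : ℝ × Ω => perturbedCost α ξ η r.1 r.1 r.2 r.2) (g := fun _ => δ)
      ?_ (by fun_prop) ?_
    · simp only [perturbedCost, sub_self, norm_zero]
      simp only [ne_eq, OfNat.ofNat_ne_zero, not_false_eq_true, zero_pow, zero_div]
      fun_prop
    · simpa [perturbedCost] using hδ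
  obtain ⟨τ, ⟨hτend, hτstart⟩, hτ⟩ :=
    ((((hend.and hstart).filter_mono nhdsWithin_le_nhds).and
      (Ioc_mem_nhdsGT (zero_lt_one' ℝ))).exists :
      ∃ τ, _ ∧ τ ∈ Ioc (0:ℝ) 1)
  have hs0 : shiftedTime τ 0 = τ := by
    rw [shiftedTime_eq hτ.1 (by linarith [hτ.1]), zero_add]
  have hs1 : shiftedTime τ 1 = 1 + τ := shiftedTime_eq hτ.1 (by linarith [hτ.1])
  obtain ⟨F, -, hF⟩ := isCompact_univ.elim_nhds_subcover (X := Ω)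
    (fun z => {x : Ω | f z + perturbedCost α ξ η τ τ z x < f x + δ}) (fun z _ => by
      refine IsOpen.mem_nhds (isOpen_lt ?_ (by fun_prop)) ?_
      · unfold perturbedCost
        fun_prop
      · have := hτstart z (mem_univ _)
        simpa using this)
  have hFne : F.Nonempty := by
    obtain ⟨x⟩ := ‹Nonempty Ω›
    obtain ⟨z, hz, -⟩ := mem_iUnion₂.1 (hF (mem_univ x))
    exact ⟨z, hz⟩
  obtain ⟨φ, hφc, hφle, hφge, hφhj⟩ := exists_softmin hFne
    (h := fun (z : Ω) p => f z + perturbedCost α ξ η τ (shiftedTime τ p.1) z p.2)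
    (fun z => contDiff_const.add (contDiff_perturbedCost α ξ η hτ.1 z)) (half_pos hδ)
  refine ⟨φ, hφc, fun x => ?_, fun y => ?_, fun p => ?_⟩
  · obtain ⟨z, hz, hzx⟩ := mem_iUnion₂.1 (hF (mem_univ x))
    have h := hφle z hz (0, x)
    simp only [hs0, mem_ofPred_eq] at h hzx
    linarith
  · have h := hφge (1, y) (g y - δ / 2) fun z _ => by
      simp only [hs1]
      exact (hτend (z, y) (mem_univ _)).le
    linarith
  · refine hφhj _ _ fun z _ => ?_
    have h1 : hjExpr (fun q : ℝ × Euc d =>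
        f z + perturbedCost α ξ η τ (shiftedTime τ q.1) z q.2) (STemb p)
        = hjExpr (fun q : ℝ × Euc d => perturbedCost α ξ η τ (shiftedTime τ q.1) z q.2)
          ((p.1 : ℝ), (p.2 : Euc d)) := by
      simp only [hjExpr, fderiv_const_add, STemb]
    rw [h1, hjExpr_perturbedCost α ξ η hτ.1 z p.2 p.1.2.1, mul_comm C]
    exact add_le_add le_rfl (mul_le_mul_of_nonneg_left
      (hC τ ⟨hτ.1.le, hτ.2⟩ p.1 p.1.2 z p.2) (sq_nonneg η))

/-- The action of `(ρ, m)` is at most `J`. -/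
def ActionLe {X : Type*} [MeasurableSpace X] [TopologicalSpace X] (ρ : SignedMeasure X)
    (m : Fin d → SignedMeasure X) (J : ℝ) : Prop :=
  ∀ (a : C(X, ℝ)) (b : C(X, Euc d)), (∀ x, a x + ‖b x‖ ^ 2 / 2 ≤ 0) → sInt ρ a + vInt m b ≤ J

lemma actionBB_le_ofReal_iff {X : Type*} [MeasurableSpace X] [TopologicalSpace X]
    {ρ : SignedMeasure X} {m : Fin d → SignedMeasure X} {J : ℝ} (hJ : 0 ≤ J) :
    actionBB ρ m ≤ ENNReal.ofReal J ↔ ActionLe ρ m J := by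
  unfold actionBB ActionLe
  rw [iSup_le_iff]
  constructor
  · intro h a b hab
    exact (ENNReal.ofReal_le_ofReal_iff hJ).1 (h ⟨(a, b), hab⟩)
  · rintro h ⟨⟨a, b⟩, hab⟩
    exact ENNReal.ofReal_le_ofReal (h a b hab)

lemma continuous_fderiv_STemb {φ : ℝ × Euc d → ℝ} (hφ : ContDiff ℝ 1 φ) (v : ℝ × Euc d) :
    Continuous fun p : STt d Ω => fderiv ℝ φ (STemb p) v := by
  have h1 : Continuous fun p : STt d Ω => STemb p := by
    unfold STemb
    fun_prop
  exact ((hφ.continuous_fderiv (by norm_num)).comp h1).clm_apply continuous_const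

theorem weak_duality [CompactSpace Ω] [Nonempty Ω] (α : ℝ) (ξ : Euc d)
    {μ ν : Measure Ω} [IsFiniteMeasure μ] [IsFiniteMeasure ν]
    {ρ : SignedMeasure (STt d Ω)} {m : Fin d → SignedMeasure (STt d Ω)} {J : ℝ}
    (hCE : CEeq d Ω μ.toSignedMeasure ν.toSignedMeasure ρ m) (hJ : ActionLe ρ m J) :
    ∃ C, ∀ (η : ℝ) (f g : C(Ω, ℝ)),
      (∀ x y, g y - f x ≤ quadCost Ω (x, y) + η * segExp Ω α ξ (x, y)) →
      (∫ x, g x ∂ν) - ∫ x, f x ∂μ ≤ J + η * sInt ρ (stExp Ω α ξ) + C * η ^ 2 := by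
  obtain ⟨C, hC⟩ := exists_subsolution (Ω := Ω) α ξ
  refine ⟨C * sInt ρ fun _ => 1, fun η f g hfg => ?_⟩
  have key : ∀ δ > 0, (∫ x, g x ∂ν) - ∫ x, f x ∂μ ≤
      J + η * sInt ρ (stExp Ω α ξ) + C * (sInt ρ fun _ => 1) * η ^ 2
        + δ * (ν.real univ + μ.real univ) := by
    intro δ hδ
    obtain ⟨φ, hφ, h0, h1, hhj⟩ := hC η f g hfg δ hδ
    have hce := hCE φ hφ
    have hφ1 : Continuous fun x : Ω => φ (1, x) := hφ.continuous.comp (by fun_prop)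
    have hφ0 : Continuous fun x : Ω => φ (0, x) := hφ.continuous.comp (by fun_prop)
    rw [sInt_toSignedMeasure _ hφ1, sInt_toSignedMeasure _ hφ0] at hce
    have hdt := continuous_fderiv_STemb (Ω := Ω) hφ (1, 0)
    have hsub : Continuous fun p : STt d Ω => η * stExp Ω α ξ p + (C * η ^ 2) * 1 := by fun_prop
    let a : C(STt d Ω, ℝ) :=
      ⟨fun p => fderiv ℝ φ (STemb p) (1, 0) - (η * stExp Ω α ξ p + (C * η ^ 2) * 1),
        hdt.sub hsub⟩
    let b : C(STt d Ω, Euc d) :=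
      ⟨fun p => WithLp.toLp 2 fun i => fderiv ℝ φ (STemb p) (0, EuclideanSpace.single i 1),
        (PiLp.continuous_toLp 2 _).comp
          (continuous_pi fun i => continuous_fderiv_STemb hφ _)⟩
    have hab := hJ a b fun p => by
      have := hhj p
      rw [hjExpr] at this
      simp only [a, b, ContinuousMap.coe_mk, EuclideanSpace.real_norm_sq_eq]
      linarith
    have ha : sInt ρ a = sInt ρ (fun p => fderiv ℝ φ (STemb p) (1, 0))
        - (η * sInt ρ (stExp Ω α ξ) + (C * η ^ 2) * sInt ρ fun _ => 1) := by
      rw [← sInt_const_mul, ← sInt_const_mul, ← sInt_add_right _ (by fun_prop) (by fun_prop),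
        ← sInt_sub_right _ hdt hsub]
      rfl
    have hb : vInt m b
        = ∑ i, sInt (m i) fun p => fderiv ℝ φ (STemb p) (0, EuclideanSpace.single i 1) := rfl
    have hg : (∫ x, g x ∂ν) - δ * ν.real univ ≤ ∫ x : Ω, φ (1, x) ∂ν := by
      have : (∫ x, (g x - δ) ∂ν) ≤ ∫ x : Ω, φ (1, x) ∂ν :=
        integral_mono (integrable_of_continuous _ (by fun_prop)) (integrable_of_continuous _ hφ1) h1
      rw [integral_sub (integrable_of_continuous _ g.continuous) (integrable_const _),
        integral_const, smul_eq_mul] at this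
      linarith
    have hf : ∫ x : Ω, φ (0, x) ∂μ ≤ (∫ x, f x ∂μ) + δ * μ.real univ := by
      have : ∫ x : Ω, φ (0, x) ∂μ ≤ (∫ x, (f x + δ) ∂μ) :=
        integral_mono (integrable_of_continuous _ hφ0) (integrable_of_continuous _ (by fun_prop)) h0
      rw [integral_add (integrable_of_continuous _ f.continuous) (integrable_const _),
        integral_const, smul_eq_mul] at this
      linarith
    linarith
  have hlim : Tendsto (fun δ : ℝ => J + η * sInt ρ (stExp Ω α ξ) + C * (sInt ρ fun _ => 1) * η ^ 2
      + δ * (ν.real univ + μ.real univ)) (𝓝[>] 0)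
      (𝓝 (J + η * sInt ρ (stExp Ω α ξ) + C * (sInt ρ fun _ => 1) * η ^ 2)) := by
    refine Tendsto.mono_left ?_ nhdsWithin_le_nhds
    refine Continuous.tendsto' (by fun_prop) _ _ (by simp)
  exact ge_of_tendsto hlim (eventually_mem_nhdsWithin.mono key)

end WeakDuality

section Competitor

lemma exists_signedMeasure_sInt_eq {X Y : Type*}
    [TopologicalSpace X] [CompactSpace X] [MeasurableSpace X] [BorelSpace X]
    [TopologicalSpace Y] [CompactSpace Y] [MeasurableSpace Y] [BorelSpace Y]
    (μ : Measure X) [IsFiniteMeasure μ] {F : X → Y} (hF : Continuous F) {k : X → ℝ}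
    (hk : Continuous k) :
    ∃ s : SignedMeasure Y, ∀ f : Y → ℝ, Continuous f → sInt s f = ∫ x, k x * f (F x) ∂μ := by
  have hfin : ∀ k : X → ℝ, Continuous k →
      IsFiniteMeasure (μ.withDensity fun x => ((k x).toNNReal : ℝ≥0∞)) := fun k hk =>
    isFiniteMeasure_withDensity_ofReal (integrable_of_continuous μ hk).2
  have hint : ∀ k : X → ℝ, Continuous k → ∀ f : Y → ℝ, Continuous f →
      ∫ y, f y ∂((μ.withDensity fun x => ((k x).toNNReal : ℝ≥0∞)).map F)
        = ∫ x, max (k x) 0 * f (F x) ∂μ := fun k hk f hf => by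
    rw [integral_map hF.measurable.aemeasurable hf.aestronglyMeasurable,
      integral_withDensity_eq_integral_smul (by fun_prop)]
    rfl
  have := hfin k hk
  have := hfin (fun x => -k x) hk.neg
  refine ⟨((μ.withDensity fun x => ((k x).toNNReal : ℝ≥0∞)).map F).toSignedMeasure
    - ((μ.withDensity fun x => ((-k x).toNNReal : ℝ≥0∞)).map F).toSignedMeasure, fun f hf => ?_⟩
  rw [sInt_eq_of_eq_sub rfl hf, hint k hk f hf, hint (fun x => -k x) hk.neg f hf,
    ← integral_sub (integrable_of_continuous _ (by fun_prop))
      (integrable_of_continuous _ (by fun_prop))]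
  refine integral_congr_ae (Eventually.of_forall fun x => ?_)
  simp only
  rcases le_total (k x) 0 with h | h
  · rw [max_eq_right h, max_eq_left (neg_nonneg.2 h)]
    ring
  · rw [max_eq_left h, max_eq_right (neg_nonpos.2 h)]
    ring

variable {d : ℕ} {Ω : Set (Euc d)}

/-- The point at time `s` of the constant-speed segment between two points of `Ω`. -/
def segPoint (hconv : Convex ℝ Ω) (q : Icc (0:ℝ) 1 × (Ω × Ω)) : STt d Ω :=
  (q.1, ⟨(q.2.1 : Euc d) + (q.1 : ℝ) • ((q.2.2 : Euc d) - q.2.1),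
    hconv.add_smul_sub_mem q.2.1.2 q.2.2.2 q.1.2⟩)

lemma continuous_segPoint (hconv : Convex ℝ Ω) : Continuous (segPoint hconv) := by
  unfold segPoint
  fun_prop

lemma integral_Icc_deriv_segment {φ : ℝ × Euc d → ℝ} (hφ : ContDiff ℝ 1 φ) (x y : Euc d) :
    ∫ s : Icc (0:ℝ) 1, fderiv ℝ φ ((s : ℝ), x + (s : ℝ) • (y - x)) (1, y - x)
      = φ (1, y) - φ (0, x) := by
  have hd : ∀ s ∈ uIcc (0:ℝ) 1, HasDerivAt (fun s : ℝ => φ (s, x + s • (y - x)))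
      (fderiv ℝ φ (s, x + s • (y - x)) (1, y - x)) s := by
    intro s _
    have h1 : HasDerivAt (fun s : ℝ => (s, x + s • (y - x))) (1, y - x) s := by
      refine (hasDerivAt_id s).prodMk ?_
      simpa using ((hasDerivAt_id s).smul_const (y - x)).const_add x
    exact ((hφ.differentiable (by norm_num) _).hasFDerivAt).comp_hasDerivAt s h1
  have hc : Continuous fun s : ℝ => fderiv ℝ φ (s, x + s • (y - x)) (1, y - x) :=
    ((hφ.continuous_fderiv (by norm_num)).comp (by fun_prop)).clm_apply continuous_const
  rw [integral_subtype measurableSet_Icc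
    (fun s : ℝ => fderiv ℝ φ (s, x + s • (y - x)) (1, y - x)),
    integral_Icc_eq_integral_Ioc, ← intervalIntegral.integral_of_le zero_le_one,
    intervalIntegral.integral_eq_sub_of_hasDerivAt hd (hc.intervalIntegrable _ _)]
  simp

theorem IsPlan.exists_competitor [CompactSpace Ω] (hconv : Convex ℝ Ω)
    {μ ν : Measure Ω} [IsFiniteMeasure μ] [IsFiniteMeasure ν] {π : Measure (Ω × Ω)}
    (hπ : IsPlan μ ν π) :
    ∃ (ρ : SignedMeasure (STt d Ω)) (m : Fin d → SignedMeasure (STt d Ω)),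
      CEeq d Ω μ.toSignedMeasure ν.toSignedMeasure ρ m ∧
      ActionLe ρ m (∫ p, quadCost Ω p ∂π) := by
  have := hπ.finite
  set Λ : Measure (Icc (0:ℝ) 1 × (Ω × Ω)) := (volume : Measure (Icc (0:ℝ) 1)).prod π with hΛ
  have hF := continuous_segPoint hconv
  have hv : ∀ i, Continuous fun q : Icc (0:ℝ) 1 × (Ω × Ω) =>
      ((q.2.2 : Euc d) - q.2.1) i := fun i => by fun_prop
  have hρ : ∀ f : STt d Ω → ℝ, Continuous f →
      sInt (Λ.map (segPoint hconv)).toSignedMeasure f = ∫ q, f (segPoint hconv q) ∂Λ :=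
    fun f hf => by
      rw [sInt_toSignedMeasure _ hf, integral_map hF.measurable.aemeasurable
        hf.aestronglyMeasurable]
  choose m hm using fun i => exists_signedMeasure_sInt_eq Λ hF (hv i)
  have hpair : ∀ (a : STt d Ω → ℝ) (b : Fin d → STt d Ω → ℝ), Continuous a →
      (∀ i, Continuous (b i)) →
      sInt (Λ.map (segPoint hconv)).toSignedMeasure a + ∑ i, sInt (m i) (b i)
        = ∫ q, (a (segPoint hconv q) +
            ∑ i, ((q.2.2 : Euc d) - q.2.1) i * b i (segPoint hconv q)) ∂Λ := by
    intro a b ha hb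
    have h1 : ∀ i, Continuous fun q => ((q.2.2 : Euc d) - q.2.1) i * b i (segPoint hconv q) :=
      fun i => (hv i).mul ((hb i).comp hF)
    have h2 : Continuous fun q => a (segPoint hconv q) := ha.comp hF
    rw [hρ a ha, Finset.sum_congr rfl fun i _ => hm i _ (hb i),
      integral_add (integrable_of_continuous _ h2)
        (integrable_of_continuous _ (continuous_finsetSum _ fun i _ => h1 i)),
      integral_finsetSum _ fun i _ => integrable_of_continuous _ (h1 i)]
  refine ⟨(Λ.map (segPoint hconv)).toSignedMeasure, m, fun φ hφ => ?_, fun a b hab => ?_⟩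
  · have hc := fun v => continuous_fderiv_STemb (Ω := Ω) hφ v
    have h1 : ∀ q : Icc (0:ℝ) 1 × (Ω × Ω),
        fderiv ℝ φ (STemb (segPoint hconv q)) (1, 0) + ∑ i, ((q.2.2 : Euc d) - q.2.1) i *
          fderiv ℝ φ (STemb (segPoint hconv q)) (0, EuclideanSpace.single i 1)
        = fderiv ℝ φ ((q.1 : ℝ), (q.2.1 : Euc d) + (q.1 : ℝ) • ((q.2.2 : Euc d) - q.2.1))
          (1, (q.2.2 : Euc d) - q.2.1) := by
      intro q
      change fderiv ℝ φ ((q.1 : ℝ), (q.2.1 : Euc d) + (q.1 : ℝ) • ((q.2.2 : Euc d) - q.2.1)) (1, 0)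
        + ∑ i, ((q.2.2 : Euc d) - q.2.1) i * fderiv ℝ φ ((q.1 : ℝ), (q.2.1 : Euc d) +
          (q.1 : ℝ) • ((q.2.2 : Euc d) - q.2.1)) (0, EuclideanSpace.single i 1) = _
      generalize (q.2.2 : Euc d) - q.2.1 = v
      generalize fderiv ℝ φ ((q.1 : ℝ), (q.2.1 : Euc d) + (q.1 : ℝ) • v) = L
      have h2 : ((1, v) : ℝ × Euc d)
          = (1, 0) + ∑ i, v i • ((0, EuclideanSpace.single i 1) : ℝ × Euc d) := by
        have h3 : v = ∑ i, v i • EuclideanSpace.single i (1 : ℝ) := by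
          simpa using ((EuclideanSpace.basisFun (Fin d) ℝ).sum_repr v).symm
        refine Prod.ext ?_ ?_
        · simp [Prod.fst_sum]
        · simpa [Prod.snd_sum] using h3
      rw [h2, map_add, map_sum]
      simp only [map_smul, smul_eq_mul]
    have hcont : Continuous fun q : Icc (0:ℝ) 1 × (Ω × Ω) =>
        fderiv ℝ φ ((q.1 : ℝ), (q.2.1 : Euc d) + (q.1 : ℝ) • ((q.2.2 : Euc d) - q.2.1))
          (1, (q.2.2 : Euc d) - q.2.1) :=
      ((hφ.continuous_fderiv (by norm_num)).comp (by fun_prop)).clm_apply (by fun_prop)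
    have hφ1 : Continuous fun x : Ω => φ (1, x) := hφ.continuous.comp (by fun_prop)
    have hφ0 : Continuous fun x : Ω => φ (0, x) := hφ.continuous.comp (by fun_prop)
    have hφ1' : Continuous fun p : Ω × Ω => φ (1, p.2) := hφ1.comp continuous_snd
    have hφ0' : Continuous fun p : Ω × Ω => φ (0, p.1) := hφ0.comp continuous_fst
    rw [hpair _ _ (hc _) fun i => hc _]
    simp only [h1]
    rw [hΛ, integral_prod_symm _ (integrable_of_continuous _ hcont),
      sInt_toSignedMeasure _ hφ1, sInt_toSignedMeasure _ hφ0, ← hπ.integral_fst hφ0,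
      ← hπ.integral_snd hφ1, ← integral_sub
        (integrable_of_continuous _ hφ1') (integrable_of_continuous _ hφ0')]
    exact integral_congr_ae (Eventually.of_forall fun p => integral_Icc_deriv_segment hφ p.1 p.2)
  · have hb : ∀ i, Continuous fun p => b p i := fun i => by fun_prop
    have h1 := hpair a (fun i p => b p i) a.continuous hb
    have h2 : Continuous fun q : Icc (0:ℝ) 1 × (Ω × Ω) => a (segPoint hconv q) +
        ∑ i, ((q.2.2 : Euc d) - q.2.1) i * b (segPoint hconv q) i := by fun_prop
    calc _ = ∫ q, (a (segPoint hconv q) +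
            ∑ i, ((q.2.2 : Euc d) - q.2.1) i * b (segPoint hconv q) i) ∂Λ := h1
      _ ≤ ∫ q, quadCost Ω q.2 ∂Λ := by
        refine integral_mono (integrable_of_continuous _ h2)
          (integrable_of_continuous _ (by fun_prop)) fun q => ?_
        have h3 := hab (segPoint hconv q)
        have h4 : quadCost Ω q.2 = ‖(q.2.2 : Euc d) - q.2.1‖ ^ 2 / 2 := rfl
        simp only
        rw [h4]
        generalize (q.2.2 : Euc d) - q.2.1 = v
        generalize b (segPoint hconv q) = w at *
        have h5 : ∑ i, v i * w i ≤ (‖v‖ ^ 2 + ‖w‖ ^ 2) / 2 := by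
          rw [EuclideanSpace.real_norm_sq_eq, EuclideanSpace.real_norm_sq_eq,
            ← Finset.sum_add_distrib, Finset.sum_div]
          refine Finset.sum_le_sum fun i _ => ?_
          linarith [two_mul_le_add_sq (v i) (w i)]
        linarith
      _ = ∫ p, quadCost Ω p ∂π := by
        rw [hΛ, integral_prod_symm _ (integrable_of_continuous _ (by fun_prop))]
        simp

end Competitor

section Minimizer

variable {d : ℕ} {Ω : Set (Euc d)}

/-- `(ρ, m)` minimizes the action among the solutions of the continuity equation, and `J` is the
minimal value. -/
structure IsMinimizer (μ ν : Measure Ω) [IsFiniteMeasure μ] [IsFiniteMeasure ν]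
    (ρ : SignedMeasure (STt d Ω)) (m : Fin d → SignedMeasure (STt d Ω)) (J : ℝ) : Prop where
  ceEq : CEeq d Ω μ.toSignedMeasure ν.toSignedMeasure ρ m
  actionLe : ActionLe ρ m J
  le : ∀ σ n J', CEeq d Ω μ.toSignedMeasure ν.toSignedMeasure σ n → ActionLe σ n J' → J ≤ J'

variable {μ ν : Measure Ω} [IsFiniteMeasure μ] [IsFiniteMeasure ν]
  {ρ ρ' : SignedMeasure (STt d Ω)} {m m' : Fin d → SignedMeasure (STt d Ω)} {J J' : ℝ}

lemma IsMinimizer.value_unique (h : IsMinimizer μ ν ρ m J) (h' : IsMinimizer μ ν ρ' m' J') :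
    J = J' :=
  le_antisymm (h.le _ _ _ h'.ceEq h'.actionLe) (h'.le _ _ _ h.ceEq h.actionLe)

lemma ActionLe.nonneg {X : Type*} [MeasurableSpace X] [TopologicalSpace X]
    {ρ : SignedMeasure X} {m : Fin d → SignedMeasure X} {J : ℝ} (h : ActionLe ρ m J) : 0 ≤ J := by
  have := h 0 0 (by simp)
  simpa [sInt, vInt] using this

variable [CompactSpace Ω] [Nonempty Ω]

lemma exists_isMinimizer_of_Jfun_le (hconv : Convex ℝ Ω) (hmass : μ univ = ν univ)
    (hmin : ∀ (σ : SignedMeasure (STt d Ω)) (n : Fin d → SignedMeasure (STt d Ω)),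
      Jfun d Ω μ.toSignedMeasure ν.toSignedMeasure ρ m ≤
        Jfun d Ω μ.toSignedMeasure ν.toSignedMeasure σ n) :
    ∃ J, IsMinimizer μ ν ρ m J := by
  have hle : ∀ σ n J', CEeq d Ω μ.toSignedMeasure ν.toSignedMeasure σ n → ActionLe σ n J' →
      Jfun d Ω μ.toSignedMeasure ν.toSignedMeasure ρ m ≤ ENNReal.ofReal J' := by
    intro σ n J' h1 h2
    refine (hmin σ n).trans ?_
    rw [Jfun, if_pos h1]
    exact (actionBB_le_ofReal_iff h2.nonneg).2 h2
  obtain ⟨π, hπ, -⟩ := exists_isPlan_dual μ ν hmass (quadCost Ω)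
  obtain ⟨σ, n, h1, h2⟩ := hπ.exists_competitor hconv
  have hfin := (hle σ n _ h1 h2).trans_lt ENNReal.ofReal_lt_top
  have hCE : CEeq d Ω μ.toSignedMeasure ν.toSignedMeasure ρ m := by
    by_contra h
    rw [Jfun, if_neg h] at hfin
    exact lt_irrefl _ hfin
  rw [Jfun, if_pos hCE] at hfin hle
  refine ⟨(actionBB ρ m).toReal, hCE, (actionBB_le_ofReal_iff ENNReal.toReal_nonneg).1
    (ENNReal.ofReal_toReal hfin.ne).ge, fun σ n J' h3 h4 => ?_⟩
  exact ENNReal.toReal_le_of_le_ofReal h4.nonneg (hle σ n J' h3 h4)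

lemma IsMinimizer.exists_isOptimalPlan (h : IsMinimizer μ ν ρ m J) (hconv : Convex ℝ Ω)
    (hmass : μ univ = ν univ) (α : ℝ) (ξ : Euc d) (ε : ℝ) :
    ∃ π, IsOptimalPlan μ ν π ∧ ε * ∫ p, segExp Ω α ξ p ∂π ≤ ε * sInt ρ (stExp Ω α ξ) := by
  obtain ⟨C, hC⟩ := weak_duality α ξ h.ceEq h.actionLe
  have hlow : ∀ π, IsPlan μ ν π → J ≤ ∫ p, quadCost Ω p ∂π := fun π hπ => by
    obtain ⟨σ, n, h1, h2⟩ := hπ.exists_competitor hconv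
    exact h.le _ _ _ h1 h2
  have hplan : ∀ η : ℝ, ∃ π, IsPlan μ ν π ∧
      ∫ p, quadCost Ω p ∂π + η * ∫ p, segExp Ω α ξ p ∂π
        ≤ J + η * sInt ρ (stExp Ω α ξ) + C * η ^ 2 := by
    intro η
    obtain ⟨π, hπ, hdual⟩ := exists_isPlan_dual μ ν hmass (quadCost Ω + η • segExp Ω α ξ)
    have := hπ.finite
    refine ⟨π, hπ, le_of_forall_pos_le_add fun δ hδ => ?_⟩
    obtain ⟨f, g, hfg, h1⟩ := hdual δ hδ
    have h2 := hC η f g hfg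
    have h3 : ∫ p, (quadCost Ω + η • segExp Ω α ξ) p ∂π
        = ∫ p, quadCost Ω p ∂π + η * ∫ p, segExp Ω α ξ p ∂π := by
      rw [← integral_const_mul, ← integral_add (integrable_of_continuous _ (by fun_prop))
        (integrable_of_continuous _ (by fun_prop))]
      rfl
    linarith
  choose π hπ hval using fun n : ℕ => hplan (ε * (1 / ((n : ℝ) + 1)))
  obtain ⟨π₀, hπ₀, hlim⟩ := exists_isPlan_tendsto π hπ (hyperfilter ℕ)
  have hη : Tendsto (fun n : ℕ => 1 / ((n : ℝ) + 1)) (hyperfilter ℕ : Filter ℕ) (𝓝 0) :=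
    tendsto_one_div_add_atTop_nhds_zero_nat.mono_left Nat.hyperfilter_le_atTop
  have hcost : ∫ p, quadCost Ω p ∂π₀ ≤ J := by
    have h1 : Tendsto (fun n : ℕ => J + ε * (1 / ((n : ℝ) + 1)) * sInt ρ (stExp Ω α ξ)
        + C * (ε * (1 / ((n : ℝ) + 1))) ^ 2 - ε * (1 / ((n : ℝ) + 1)) *
          ∫ p, segExp Ω α ξ p ∂(π n)) (hyperfilter ℕ : Filter ℕ)
        (𝓝 (J + ε * 0 * sInt ρ (stExp Ω α ξ) + C * (ε * 0) ^ 2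
          - ε * 0 * ∫ p, segExp Ω α ξ p ∂π₀)) :=
      ((((hη.const_mul ε).mul_const _).const_add J).add
        (((hη.const_mul ε).pow 2).const_mul C)).sub ((hη.const_mul ε).mul (hlim _))
    have h2 := le_of_tendsto_of_tendsto (hlim (quadCost Ω)) h1
      (Eventually.of_forall fun n => by
        have := hval n
        simp only
        linarith)
    simpa using h2
  refine ⟨π₀, ⟨hπ₀, fun π' hπ' => hcost.trans (hlow π' hπ')⟩, ?_⟩
  have h1 : Tendsto (fun n : ℕ => ε * sInt ρ (stExp Ω α ξ) + C * ε ^ 2 * (1 / ((n : ℝ) + 1)))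
      (hyperfilter ℕ : Filter ℕ) (𝓝 (ε * sInt ρ (stExp Ω α ξ) + C * ε ^ 2 * 0)) :=
    (hη.const_mul _).const_add _
  have h2 := le_of_tendsto_of_tendsto ((hlim (segExp Ω α ξ)).const_mul ε) h1
    (Eventually.of_forall fun n => by
      have h3 := hval n
      have h4 := hlow _ (hπ n)
      have h5 : (0 : ℝ) < 1 / ((n : ℝ) + 1) := by positivity
      simp only
      generalize 1 / ((n : ℝ) + 1) = r at *
      refine le_of_mul_le_mul_left ?_ h5
      linarith)
  simpa using h2

theorem IsMinimizer.sInt_stExp_eq (h : IsMinimizer μ ν ρ m J) (hΩ : IsCompact Ω)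
    (hconv : Convex ℝ Ω) (hmass : μ univ = ν univ)
    (hac : μ.map Subtype.val ≪ (volume : Measure (Euc d)) ∨
      ν.map Subtype.val ≪ (volume : Measure (Euc d)))
    {π : Measure (Ω × Ω)} (hπ : IsOptimalPlan μ ν π) (α : ℝ) (ξ : Euc d) :
    sInt ρ (stExp Ω α ξ) = ∫ p, segExp Ω α ξ p ∂π := by
  obtain ⟨π₁, h1, h1'⟩ := h.exists_isOptimalPlan hconv hmass α ξ 1
  obtain ⟨π₂, h2, h2'⟩ := h.exists_isOptimalPlan hconv hmass α ξ (-1)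
  rw [h1.unique_of_or hΩ hconv hmass hac hπ] at h1'
  rw [h2.unique_of_or hΩ hconv hmass hac hπ] at h2'
  linarith

end Minimizer

section Density

variable {d : ℕ} {Ω : Set (Euc d)} [CompactSpace Ω]

lemma signedMeasure_ext_of_stExp {ρ ρ' : SignedMeasure (STt d Ω)}
    (h : ∀ α ξ, sInt ρ (stExp Ω α ξ) = sInt ρ' (stExp Ω α ξ)) : ρ = ρ' := by
  let S : Submonoid C(STt d Ω, ℝ) :=
    { carrier := range fun q : ℝ × Euc d => stExp Ω q.1 q.2
      one_mem' := ⟨0, by ext p; simp [stExp]⟩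
      mul_mem' := by
        rintro _ _ ⟨q, rfl⟩ ⟨r, rfl⟩
        refine ⟨q + r, ?_⟩
        ext p
        simp only [stExp, ContinuousMap.coe_mk, ContinuousMap.mul_apply, ← Real.exp_add,
          Prod.fst_add, Prod.snd_add, inner_add_left]
        congr 1
        ring }
  let A : Subalgebra ℝ C(STt d Ω, ℝ) := Algebra.adjoin ℝ (S : Set C(STt d Ω, ℝ))
  have hsep : A.SeparatesPoints := by
    intro p q hpq
    have key : ∀ α ξ, stExp Ω α ξ p ≠ stExp Ω α ξ q → ∃ f ∈ (fun f : C(STt d Ω, ℝ) => (f : _ → ℝ)) ''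
        (A : Set C(STt d Ω, ℝ)), f p ≠ f q := fun α ξ hne =>
      ⟨_, ⟨stExp Ω α ξ, Algebra.subset_adjoin ⟨(α, ξ), rfl⟩, rfl⟩, hne⟩
    by_cases h1 : p.1 = q.1
    · have h2 : (p.2 : Euc d) - q.2 ≠ 0 := fun h2 =>
        hpq (Prod.ext h1 (Subtype.ext (sub_eq_zero.1 h2)))
      refine key 0 ((p.2 : Euc d) - q.2) fun h3 => h2 ?_
      have h4 := Real.exp_injective h3
      rw [h1, add_right_inj, ← sub_eq_zero, ← inner_sub_right] at h4
      exact inner_self_eq_zero.1 h4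
    · refine key 1 0 fun h3 => h1 (Subtype.ext ?_)
      simpa using Real.exp_injective h3
  have htop := ContinuousMap.subalgebra_topologicalClosure_eq_top_of_separatesPoints A hsep
  have hcl : IsClosed {f : C(STt d Ω, ℝ) | sIntLinear ρ f = sIntLinear ρ' f} :=
    isClosed_eq (continuous_sIntLinear ρ) (continuous_sIntLinear ρ')
  have hA : (A : Set C(STt d Ω, ℝ)) ⊆ {f | sIntLinear ρ f = sIntLinear ρ' f} := by
    intro f hf
    have hf' : f ∈ Submodule.span ℝ (S : Set C(STt d Ω, ℝ)) := by
      have h1 : f ∈ Subalgebra.toSubmodule A := hf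
      rwa [Algebra.adjoin_eq_span, Submonoid.closure_eq] at h1
    have hle : Submodule.span ℝ (S : Set C(STt d Ω, ℝ))
        ≤ LinearMap.eqLocus (sIntLinear ρ) (sIntLinear ρ') := by
      rw [Submodule.span_le]
      rintro _ ⟨q, rfl⟩
      exact h q.1 q.2
    exact hle hf'
  refine signedMeasure_ext_of_sInt fun f => ?_
  have hf : f ∈ A.topologicalClosure := htop ▸ Algebra.mem_top
  exact hcl.closure_subset_iff.2 hA hf

end Density

section Momentum

variable {X : Type*} [TopologicalSpace X] [MeasurableSpace X]
  {d : ℕ} {ρ : SignedMeasure X} {m m' : Fin d → SignedMeasure X} {J : ℝ}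

lemma vInt_const_smul (m : Fin d → SignedMeasure X) (c : ℝ) (b : C(X, Euc d)) :
    vInt m (fun x => c • b x) = c * vInt m b := by
  unfold vInt
  rw [Finset.mul_sum]
  exact Finset.sum_congr rfl fun i _ => sInt_const_mul (m i) c fun x => b x i

lemma ActionLe.sInt_nonpos (h : ActionLe ρ m J) {a : C(X, ℝ)} (ha : ∀ x, a x ≤ 0) :
    sInt ρ a ≤ 0 := by
  by_contra! hpos
  have h1 := h ((J / sInt ρ a + 1) • a) 0 fun x => by
    have : 0 ≤ J / sInt ρ a := div_nonneg h.nonneg hpos.le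
    simpa using mul_nonpos_of_nonneg_of_nonpos (by linarith) (ha x)
  have h2 : vInt m (0 : C(X, Euc d)) = 0 := by simp [vInt, sInt]
  have h3 : sInt ρ ((J / sInt ρ a + 1) • a : C(X, ℝ)) = (J / sInt ρ a + 1) * sInt ρ a :=
    sInt_const_mul ρ _ a
  rw [h2, h3, add_mul, div_mul_cancel₀ _ hpos.ne'] at h1
  linarith

lemma ActionLe.vInt_le (h : ActionLe ρ m J) (b : C(X, Euc d)) :
    vInt m b ≤ J + sInt ρ (fun x => ‖b x‖ ^ 2) / 2 := by
  have h1 := h ⟨fun x => (-1 / 2) * ‖b x‖ ^ 2, by fun_prop⟩ b fun x => by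
    simp only [ContinuousMap.coe_mk]
    linarith
  simp only [ContinuousMap.coe_mk] at h1
  rw [sInt_const_mul] at h1
  linarith

variable [CompactSpace X] [BorelSpace X]

lemma vInt_add_right (m : Fin d → SignedMeasure X) (b e : C(X, Euc d)) :
    vInt m (fun x => b x + e x) = vInt m b + vInt m e := by
  unfold vInt
  rw [← Finset.sum_add_distrib]
  exact Finset.sum_congr rfl fun i _ => sInt_add_right (m i) (f := fun x => b x i)
    (g := fun x => e x i) (by fun_prop) (by fun_prop)

lemma ActionLe.of_vInt_le (h : ActionLe ρ m J) {K : ℝ}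
    (h' : ∀ b : C(X, Euc d), vInt m' b ≤ K + sInt ρ (fun x => ‖b x‖ ^ 2) / 2) :
    ActionLe ρ m' K := by
  intro a b hab
  have h1 := h.sInt_nonpos (a := ⟨fun x => a x + (1 / 2) * ‖b x‖ ^ 2, by fun_prop⟩) fun x => by
    have := hab x
    simp only [ContinuousMap.coe_mk]
    linarith
  simp only [ContinuousMap.coe_mk] at h1
  rw [sInt_add_right _ a.continuous (by fun_prop), sInt_const_mul] at h1
  linarith [h' b]

lemma eq_zero_of_forall_mul_le_sq_mul {n q : ℝ} (h : ∀ r : ℝ, r * n ≤ r ^ 2 * q) : n = 0 := by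
  have hq : 0 ≤ q := by linarith [h 1, h (-1)]
  have h1 := h (n / (q + 1))
  rw [div_pow, div_mul_eq_mul_div, div_mul_eq_mul_div, div_le_div_iff₀ (by positivity)
    (by positivity)] at h1
  have h2 : 0 ≤ n ^ 2 * (q + 1) := by positivity
  have h3 : n ^ 2 * (q + 1) ≤ 0 := by nlinarith
  have h4 : n ^ 2 = 0 := by
    have : 0 < q + 1 := by positivity
    nlinarith [sq_nonneg n]
  exact pow_eq_zero_iff two_ne_zero |>.1 h4

/-- The average of two momenta. -/
def midMomentum (m m' : Fin d → SignedMeasure X) : Fin d → SignedMeasure X :=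
  fun i => (1 / 2 : ℝ≥0) • (m i + m' i)

lemma sInt_midMomentum (i : Fin d) {f : X → ℝ} (hf : Continuous f) :
    sInt (midMomentum m m' i) f = (sInt (m i) f + sInt (m' i) f) / 2 := by
  rw [midMomentum, sInt_smul_left _ _ hf, sInt_add_left _ _ hf]
  push_cast
  ring

lemma vInt_midMomentum (b : C(X, Euc d)) :
    vInt (midMomentum m m') b = (vInt m b + vInt m' b) / 2 := by
  unfold vInt
  rw [← Finset.sum_add_distrib, Finset.sum_div]
  exact Finset.sum_congr rfl fun i _ => sInt_midMomentum i (by fun_prop)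

lemma momentum_eq_of_midMomentum [HasOuterApproxClosed X] (h : ActionLe ρ m J)
    (h' : ActionLe ρ m' J) (hmid : ∀ K, ActionLe ρ (midMomentum m m') K → J ≤ K) : m = m' := by
  have hle : ∀ e : C(X, Euc d),
      (vInt m e - vInt m' e) / 2 ≤ sInt ρ (fun x => ‖e x‖ ^ 2) / 2 := by
    intro e
    have key := hmid (J - ((vInt m e - vInt m' e) / 2 - sInt ρ (fun x => ‖e x‖ ^ 2) / 2))
      (h.of_vInt_le fun b => ?_)
    · linarith
    have h1 := h.vInt_le (b + e)
    have h2 := h'.vInt_le (b + (-1 : ℝ) • e)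
    have h3 : vInt m (b + e : C(X, Euc d)) = vInt m b + vInt m e := vInt_add_right m b e
    have h4 : vInt m' (b + (-1 : ℝ) • e : C(X, Euc d)) = vInt m' b + (-1) * vInt m' e := by
      rw [← vInt_const_smul]
      exact vInt_add_right m' b ((-1 : ℝ) • e)
    have h5 : sInt ρ (fun x => ‖(b + e) x‖ ^ 2) + sInt ρ (fun x => ‖(b + (-1 : ℝ) • e) x‖ ^ 2)
        = 2 * sInt ρ (fun x => ‖b x‖ ^ 2) + 2 * sInt ρ (fun x => ‖e x‖ ^ 2) := by
      rw [← sInt_const_mul, ← sInt_const_mul, ← sInt_add_right _ (by fun_prop) (by fun_prop),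
        ← sInt_add_right _ (by fun_prop) (by fun_prop)]
      congr 1
      ext x
      have := parallelogram_law_with_norm ℝ (b x) (e x)
      simp only [ContinuousMap.add_apply, ContinuousMap.smul_apply, neg_smul, one_smul,
        ← sub_eq_add_neg]
      linarith
    rw [vInt_midMomentum]
    linarith
  have heq : ∀ e : C(X, Euc d), vInt m e = vInt m' e := by
    intro e
    have h0 : vInt m e - vInt m' e = 0 := eq_zero_of_forall_mul_le_sq_mul
      (q := sInt ρ fun x => ‖e x‖ ^ 2) fun r => by
        have h1 := hle (r • e)
        have h2 : ∀ n : Fin d → SignedMeasure X, vInt n (r • e : C(X, Euc d)) = r * vInt n e :=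
          fun n => vInt_const_smul n r e
        have h3 : sInt ρ (fun x => ‖(r • e) x‖ ^ 2) = r ^ 2 * sInt ρ fun x => ‖e x‖ ^ 2 := by
          rw [← sInt_const_mul]
          congr 1
          ext x
          rw [ContinuousMap.smul_apply, norm_smul, mul_pow, Real.norm_eq_abs, sq_abs]
        rw [h2, h2, h3] at h1
        linarith
    linarith
  funext i
  refine signedMeasure_ext_of_sInt fun f => ?_
  have h1 := heq ⟨fun x => EuclideanSpace.single i (f x), by
    have : (fun x => EuclideanSpace.single i (f x)) = fun x => f x • EuclideanSpace.single i (1:ℝ) := by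
      ext x j
      simp [PiLp.single_apply]
    rw [this]
    fun_prop⟩
  have h2 : ∀ n : Fin d → SignedMeasure X,
      vInt n (fun x => EuclideanSpace.single i (f x)) = sInt (n i) f := by
    intro n
    unfold vInt
    rw [Finset.sum_eq_single i]
    · simp
    · intro j _ hj
      simp [hj, sInt]
    · simp
  exact (h2 m).symm.trans (h1.trans (h2 m'))

end Momentum

/-- If `ρ₀, ρ₁ ∈ M₊(Ω)` share the same total mass and at least one of them is absolutely
continuous with respect to the Lebesgue measure, then the minimizer of `J_{ρ₀,ρ₁}` is unique. -/
theorem stmt1 {d : ℕ} (hd : 1 ≤ d) (Ω : Set (Euc d)) (hne : Ω.Nonempty)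
    (hcomp : IsCompact Ω) (hconv : Convex ℝ Ω)
    (ρ₀ ρ₁ : Measure ↥Ω) [IsFiniteMeasure ρ₀] [IsFiniteMeasure ρ₁]
    (hmass : ρ₀ Set.univ = ρ₁ Set.univ)
    (hac : ρ₀.map Subtype.val ≪ (volume : Measure (Euc d)) ∨
           ρ₁.map Subtype.val ≪ (volume : Measure (Euc d)))
    (ρ ρ' : SignedMeasure (STt d Ω)) (m m' : Fin d → SignedMeasure (STt d Ω))
    (hmin : ∀ (σ : SignedMeasure (STt d Ω)) (μ : Fin d → SignedMeasure (STt d Ω)),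
      Jfun d Ω ρ₀.toSignedMeasure ρ₁.toSignedMeasure ρ m ≤
        Jfun d Ω ρ₀.toSignedMeasure ρ₁.toSignedMeasure σ μ)
    (hmin' : ∀ (σ : SignedMeasure (STt d Ω)) (μ : Fin d → SignedMeasure (STt d Ω)),
      Jfun d Ω ρ₀.toSignedMeasure ρ₁.toSignedMeasure ρ' m' ≤
        Jfun d Ω ρ₀.toSignedMeasure ρ₁.toSignedMeasure σ μ) :
    ρ = ρ' ∧ m = m' := by
  have := isCompact_iff_compactSpace.1 hcomp
  have := hne.to_subtype
  obtain ⟨J, h⟩ := exists_isMinimizer_of_Jfun_le hconv hmass hmin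
  obtain ⟨J', h'⟩ := exists_isMinimizer_of_Jfun_le hconv hmass hmin'
  obtain rfl := h.value_unique h'
  obtain ⟨π, hπ, -⟩ := h.exists_isOptimalPlan hconv hmass 0 0 0
  obtain rfl : ρ = ρ' := signedMeasure_ext_of_stExp fun α ξ => by
    rw [h.sInt_stExp_eq hcomp hconv hmass hac hπ, h'.sInt_stExp_eq hcomp hconv hmass hac hπ]
  refine ⟨rfl, momentum_eq_of_midMomentum h.actionLe h'.actionLe
    fun K hK => h.le _ _ _ (fun φ hφ => ?_) hK⟩
  have h1 := h.ceEq φ hφ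
  have h2 := h'.ceEq φ hφ
  rw [Finset.sum_congr rfl fun i _ => sInt_midMomentum i (continuous_fderiv_STemb hφ _),
    ← Finset.sum_div, Finset.sum_add_distrib]
  linarith

end
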